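/- arXiv:2602.16460 — 4 statements merged into one kernel-verified Lean document; each statement's English description precedes it below -/
import Mathlib

section
/- Let A, B, C satisfy condition (ABC) and F(y) = 3Ay² + By + C. There exists a constant c > 0 depending only on A, B, C such that for every ξ ∈ ℝ and every C² function σ : [-1,1] → ℂ with σ(-1) = σ(1) = 0, setting φ(y) = F(y)σ(y), one has: −12A∫₋₁¹|σ'(y)|²dy − 6Aξ²∫₋₁¹|σ(y)|²dy + ∫₋₁¹F(y)(|σ''(y)|² + 2ξ²|σ'(y)|² + ξ⁴|σ(y)|²)dy ≥ c·∫₋₁¹(|σ'(y)|² + ξ²|σ(y)|² + |φ''(y)|² + 2ξ²|φ'(y)|² + ξ⁴|φ(y)|²)dy. -/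
open MeasureTheory intervalIntegral

section WeightedInequalities

variable {E : Type*} [NormedAddCommGroup E] [InnerProductSpace ℝ E]

/-- A Hardy-type inequality on `[0, 1]` for functions vanishing at the left end point. -/
lemma integral_norm_sq_le_of_eq_zero_left {w w' : ℝ → E} (hw : ∀ y, HasDerivAt w (w' y) y)
    (hw' : Continuous w') (h0 : w 0 = 0) :
    ∫ y in (0 : ℝ)..1, ‖w y‖ ^ 2 ≤ 4 * ∫ y in (0 : ℝ)..1, (1 - y) ^ 2 * ‖w' y‖ ^ 2 := by
  have hwc : Continuous w := continuous_iff_continuousAt.2 fun y => (hw y).continuousAt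
  have hd : ∀ y ∈ Set.uIcc (0 : ℝ) 1, HasDerivAt (fun y => (1 - y) * ‖w y‖ ^ 2)
      (-1 * ‖w y‖ ^ 2 + (1 - y) * (2 * inner ℝ (w y) (w' y))) y := fun y _ =>
    ((hasDerivAt_id y).const_sub 1).mul (hw y).norm_sq
  have hparts := integral_eq_sub_of_hasDerivAt hd
    (Continuous.intervalIntegrable (by fun_prop) _ _)
  simp only [h0, norm_zero] at hparts
  have hmono : ∫ y in (0 : ℝ)..1, (-1 * ‖w y‖ ^ 2 + (1 - y) * (2 * inner ℝ (w y) (w' y)))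
      ≤ ∫ y in (0 : ℝ)..1, (2 * ((1 - y) ^ 2 * ‖w' y‖ ^ 2) - 1 / 2 * ‖w y‖ ^ 2) := by
    refine integral_mono_on zero_le_one (Continuous.intervalIntegrable (by fun_prop) _ _)
      (Continuous.intervalIntegrable (by fun_prop) _ _) fun y hy => ?_
    have h1 := mul_le_mul_of_nonneg_left (real_inner_le_norm (w y) (w' y)) (sub_nonneg.2 hy.2)
    nlinarith [sq_nonneg (‖w y‖ - 2 * ((1 - y) * ‖w' y‖))]
  rw [integral_sub (Continuous.intervalIntegrable (by fun_prop) _ _)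
    (Continuous.intervalIntegrable (by fun_prop) _ _), intervalIntegral.integral_const_mul,
    intervalIntegral.integral_const_mul] at hmono
  linarith

/-- A Hardy-type inequality on `[-1, 1]` for functions vanishing at the origin. -/
lemma integral_norm_sq_le_of_eq_zero_mid {w w' : ℝ → E} (hw : ∀ y, HasDerivAt w (w' y) y)
    (hw' : Continuous w') (h0 : w 0 = 0) :
    ∫ y in (-1 : ℝ)..1, ‖w y‖ ^ 2 ≤ 4 * ∫ y in (-1 : ℝ)..1, (1 - |y|) ^ 2 * ‖w' y‖ ^ 2 := by
  have hwc : Continuous w := continuous_iff_continuousAt.2 fun y => (hw y).continuousAt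
  have hr := integral_norm_sq_le_of_eq_zero_left hw hw' h0
  have hl := integral_norm_sq_le_of_eq_zero_left (w := fun y => w (-y)) (w' := fun y => -w' (-y))
    (fun y => by
      simpa [Function.comp_def] using (hw (-y)).scomp y (hasDerivAt_neg y)) (by fun_prop) (by simpa using h0)
  have er : ∫ y in (0 : ℝ)..1, (1 - y) ^ 2 * ‖w' y‖ ^ 2
      = ∫ y in (0 : ℝ)..1, (1 - |y|) ^ 2 * ‖w' y‖ ^ 2 := by
    refine integral_congr fun y hy => ?_
    rw [Set.uIcc_of_le zero_le_one] at hy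
    simp only [abs_of_nonneg hy.1]
  have el : ∫ y in (0 : ℝ)..1, (1 - y) ^ 2 * ‖-w' (-y)‖ ^ 2
      = ∫ y in (-1 : ℝ)..0, (1 - |y|) ^ 2 * ‖w' y‖ ^ 2 := by
    have hneg := integral_comp_neg (a := 0) (b := 1) fun y => (1 - |y|) ^ 2 * ‖w' y‖ ^ 2
    rw [neg_zero] at hneg
    rw [← hneg]
    refine integral_congr fun y hy => ?_
    rw [Set.uIcc_of_le zero_le_one] at hy
    simp only [abs_neg, abs_of_nonneg hy.1, norm_neg]
  have el' : ∫ y in (0 : ℝ)..1, ‖w (-y)‖ ^ 2 = ∫ y in (-1 : ℝ)..0, ‖w y‖ ^ 2 := by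
    rw [integral_comp_neg fun y => ‖w y‖ ^ 2, neg_zero]
  rw [er] at hr
  rw [el, el'] at hl
  rw [← integral_add_adjacent_intervals (a := -1) (b := 0) (c := 1)
      (Continuous.intervalIntegrable (by fun_prop) _ _)
      (Continuous.intervalIntegrable (by fun_prop) _ _),
    ← integral_add_adjacent_intervals (a := -1) (b := 0) (c := 1)
      (f := fun y => (1 - |y|) ^ 2 * ‖w' y‖ ^ 2)
      (Continuous.intervalIntegrable (by fun_prop) _ _)
      (Continuous.intervalIntegrable (by fun_prop) _ _)]
  linarith

/-- If `σ` vanishes at `±1`, then `∫ |σ'|²` is controlled by `∫ (1 - |y|) |σ''|²`. -/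
lemma integral_norm_deriv_sq_le {σ σ₁ σ₂ : ℝ → E} (h1 : ∀ y, HasDerivAt σ (σ₁ y) y)
    (h2 : ∀ y, HasDerivAt σ₁ (σ₂ y) y) (hc : Continuous σ₂) (hl : σ (-1) = 0) (hr : σ 1 = 0) :
    ∫ y in (-1 : ℝ)..1, ‖σ₁ y‖ ^ 2 ≤ 4 * ∫ y in (-1 : ℝ)..1, (1 - |y|) * ‖σ₂ y‖ ^ 2 := by
  have hc1 : Continuous σ₁ := continuous_iff_continuousAt.2 fun y => (h2 y).continuousAt
  have hH := integral_norm_sq_le_of_eq_zero_mid (fun y => (h2 y).sub_const (σ₁ 0)) hc (sub_self _)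
  have hmean : ∫ y in (-1 : ℝ)..1, inner ℝ (σ₁ y) (σ₁ 0) = 0 := by
    have hd : ∀ y ∈ Set.uIcc (-1 : ℝ) 1, HasDerivAt (fun y => inner ℝ (σ y) (σ₁ 0))
        (inner ℝ (σ₁ y) (σ₁ 0)) y := fun y _ => by
      simpa using (h1 y).inner ℝ (hasDerivAt_const y (σ₁ 0))
    rw [integral_eq_sub_of_hasDerivAt hd (Continuous.intervalIntegrable (by fun_prop) _ _)]
    simp [hl, hr]
  have hlow : ∫ y in (-1 : ℝ)..1, (‖σ₁ y‖ ^ 2 - 2 * inner ℝ (σ₁ y) (σ₁ 0))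
      ≤ ∫ y in (-1 : ℝ)..1, ‖σ₁ y - σ₁ 0‖ ^ 2 := by
    refine integral_mono_on (by norm_num) (Continuous.intervalIntegrable (by fun_prop) _ _)
      (Continuous.intervalIntegrable (by fun_prop) _ _) fun y _ => ?_
    rw [norm_sub_sq_real]
    nlinarith [sq_nonneg ‖σ₁ 0‖]
  rw [integral_sub (Continuous.intervalIntegrable (by fun_prop) _ _)
    (Continuous.intervalIntegrable (by fun_prop) _ _), intervalIntegral.integral_const_mul, hmean] at hlow
  have hup : ∫ y in (-1 : ℝ)..1, (1 - |y|) ^ 2 * ‖σ₂ y‖ ^ 2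
      ≤ ∫ y in (-1 : ℝ)..1, (1 - |y|) * ‖σ₂ y‖ ^ 2 := by
    refine integral_mono_on (by norm_num) (Continuous.intervalIntegrable (by fun_prop) _ _)
      (Continuous.intervalIntegrable (by fun_prop) _ _) fun y hy => ?_
    have := abs_le.2 hy
    refine mul_le_mul_of_nonneg_right ?_ (sq_nonneg _)
    nlinarith [abs_nonneg y]
  linarith

/-- The Cauchy–Schwarz bound for the increment of a `C¹` function. -/
lemma norm_sub_sq_le_integral [CompleteSpace E] {σ σ₁ : ℝ → E}
    (h1 : ∀ y, HasDerivAt σ (σ₁ y) y) (hc : Continuous σ₁) {s t : ℝ} (hst : s ≤ t) :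
    ‖σ t - σ s‖ ^ 2 ≤ (t - s) * ∫ y in s..t, ‖σ₁ y‖ ^ 2 := by
  rcases hst.eq_or_lt with rfl | hlt
  · simp
  have hL : 0 < t - s := sub_pos.2 hlt
  have hN : ‖σ t - σ s‖ ≤ ∫ y in s..t, ‖σ₁ y‖ := by
    rw [← integral_eq_sub_of_hasDerivAt (fun y _ => h1 y) (hc.intervalIntegrable _ _)]
    exact norm_integral_le_integral_norm hst
  have hyoung : ∀ a : ℝ, 2 * a * ∫ y in s..t, ‖σ₁ y‖
      ≤ a ^ 2 * (t - s) + ∫ y in s..t, ‖σ₁ y‖ ^ 2 := fun a => by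
    have hmono : ∫ y in s..t, 2 * a * ‖σ₁ y‖ ≤ ∫ y in s..t, (a ^ 2 + ‖σ₁ y‖ ^ 2) :=
      integral_mono_on hst (Continuous.intervalIntegrable (by fun_prop) _ _)
        (Continuous.intervalIntegrable (by fun_prop) _ _) fun y _ => by
          nlinarith [sq_nonneg (a - ‖σ₁ y‖)]
    rw [integral_add (Continuous.intervalIntegrable (by fun_prop) _ _)
      (Continuous.intervalIntegrable (by fun_prop) _ _), intervalIntegral.integral_const_mul,
      intervalIntegral.integral_const, smul_eq_mul] at hmono
    linarith
  set N := ‖σ t - σ s‖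
  set D := ∫ y in s..t, ‖σ₁ y‖ ^ 2
  have ha : 0 ≤ N / (t - s) := div_nonneg (norm_nonneg _) hL.le
  have hN' := (mul_le_mul_of_nonneg_left hN (mul_nonneg zero_le_two ha)).trans (hyoung _)
  have e1 : 2 * (N / (t - s)) * N * (t - s) = 2 * N ^ 2 := by field_simp
  have e2 : (N / (t - s)) ^ 2 * (t - s) * (t - s) = N ^ 2 := by field_simp
  nlinarith [mul_le_mul_of_nonneg_right hN' hL.le]

/-- Pointwise bound by the Dirichlet energy for functions vanishing at `±1`. -/
lemma norm_sq_le_of_eq_zero_endpoints [CompleteSpace E] {σ σ₁ : ℝ → E}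
    (h1 : ∀ y, HasDerivAt σ (σ₁ y) y) (hc : Continuous σ₁) (hl : σ (-1) = 0) (hr : σ 1 = 0)
    {y : ℝ} (hy : y ∈ Set.Icc (-1 : ℝ) 1) :
    ‖σ y‖ ^ 2 ≤ (1 - |y|) * ∫ t in (-1 : ℝ)..1, ‖σ₁ t‖ ^ 2 := by
  have hsub : ∀ {s t : ℝ}, -1 ≤ s → s ≤ t → t ≤ 1 →
      ∫ x in s..t, ‖σ₁ x‖ ^ 2 ≤ ∫ t in (-1 : ℝ)..1, ‖σ₁ t‖ ^ 2 := fun hs hst ht =>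
    integral_mono_interval hs hst ht (ae_of_all _ fun t => sq_nonneg ‖σ₁ t‖)
      (Continuous.intervalIntegrable (by fun_prop) _ _)
  rcases le_total 0 y with h | h
  · have hb := norm_sub_sq_le_integral h1 hc hy.2
    rw [hr, zero_sub, norm_neg] at hb
    rw [abs_of_nonneg h]
    exact hb.trans (mul_le_mul_of_nonneg_left (hsub hy.1 hy.2 le_rfl) (sub_nonneg.2 hy.2))
  · have hb := norm_sub_sq_le_integral h1 hc hy.1
    rw [hl, sub_zero] at hb
    rw [abs_of_nonpos h, show 1 - -y = y - -1 by ring]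
    exact hb.trans (mul_le_mul_of_nonneg_left (hsub le_rfl hy.1 hy.2) (sub_nonneg.2 hy.1))

/-- The Poincaré inequality for functions vanishing at `±1`. -/
lemma integral_norm_sq_le_of_eq_zero_endpoints [CompleteSpace E] {σ σ₁ : ℝ → E}
    (h1 : ∀ y, HasDerivAt σ (σ₁ y) y) (hc : Continuous σ₁) (hl : σ (-1) = 0) (hr : σ 1 = 0) :
    ∫ y in (-1 : ℝ)..1, ‖σ y‖ ^ 2 ≤ 2 * ∫ y in (-1 : ℝ)..1, ‖σ₁ y‖ ^ 2 := by
  have hσ : Continuous σ := continuous_iff_continuousAt.2 fun y => (h1 y).continuousAt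
  have hD : 0 ≤ ∫ y in (-1 : ℝ)..1, ‖σ₁ y‖ ^ 2 :=
    integral_nonneg (by norm_num) fun y _ => sq_nonneg _
  have hmono : ∫ y in (-1 : ℝ)..1, ‖σ y‖ ^ 2
      ≤ ∫ _ in (-1 : ℝ)..1, ∫ y in (-1 : ℝ)..1, ‖σ₁ y‖ ^ 2 := by
    refine integral_mono_on (by norm_num) (Continuous.intervalIntegrable (by fun_prop) _ _)
      (Continuous.intervalIntegrable (by fun_prop) _ _) fun y hy => ?_
    have := norm_sq_le_of_eq_zero_endpoints h1 hc hl hr hy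
    nlinarith [abs_nonneg y]
  rw [intervalIntegral.integral_const, smul_eq_mul] at hmono
  linarith

/-- Interpolation between the Dirichlet energy and the norm with weight `1 - |y|`. -/
lemma sq_mul_integral_norm_sq_le [CompleteSpace E] {σ σ₁ : ℝ → E}
    (h1 : ∀ y, HasDerivAt σ (σ₁ y) y) (hc : Continuous σ₁) (hl : σ (-1) = 0) (hr : σ 1 = 0)
    (ξ : ℝ) :
    ξ ^ 2 * ∫ y in (-1 : ℝ)..1, ‖σ y‖ ^ 2
      ≤ 1 / 2 * (ξ ^ 4 * ∫ y in (-1 : ℝ)..1, (1 - |y|) * ‖σ y‖ ^ 2)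
        + ∫ y in (-1 : ℝ)..1, ‖σ₁ y‖ ^ 2 := by
  have hσ : Continuous σ := continuous_iff_continuousAt.2 fun y => (h1 y).continuousAt
  have hD : 0 ≤ ∫ y in (-1 : ℝ)..1, ‖σ₁ y‖ ^ 2 :=
    integral_nonneg (by norm_num) fun y _ => sq_nonneg _
  have hpt := fun y => norm_sq_le_of_eq_zero_endpoints h1 hc hl hr (y := y)
  set D := ∫ y in (-1 : ℝ)..1, ‖σ₁ y‖ ^ 2
  have hmono : ∫ y in (-1 : ℝ)..1, ξ ^ 2 * ‖σ y‖ ^ 2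
      ≤ ∫ y in (-1 : ℝ)..1, (1 / 2 * ξ ^ 4 * ((1 - |y|) * ‖σ y‖ ^ 2) + 1 / 2 * D) := by
    refine integral_mono_on (by norm_num) (Continuous.intervalIntegrable (by fun_prop) _ _)
      (Continuous.intervalIntegrable (by fun_prop) _ _) fun y hy => ?_
    have hb := hpt y hy
    rcases (sub_nonneg.2 (abs_le.2 hy)).eq_or_lt with hw | hw
    · rw [← hw] at hb ⊢
      have : ‖σ y‖ ^ 2 = 0 := le_antisymm (by linarith) (sq_nonneg _)
      rw [this]
      linarith
    · refine le_of_mul_le_mul_right ?_ hw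
      nlinarith [mul_nonneg (sq_nonneg ‖σ y‖) (sq_nonneg (ξ ^ 2 * (1 - |y|) - 1))]
  rw [integral_add (Continuous.intervalIntegrable (by fun_prop) _ _)
    (Continuous.intervalIntegrable (by fun_prop) _ _), intervalIntegral.integral_const_mul,
    intervalIntegral.integral_const_mul, intervalIntegral.integral_const, smul_eq_mul] at hmono
  linarith

end WeightedInequalities

lemma quadratic_ge_mul_one_sub_abs {A B C y : ℝ} (hA : A ≤ 0) (hB : |B| ≤ 3 * A + C)
    (hy : |y| ≤ 1) : C * (1 - |y|) ≤ 3 * A * y ^ 2 + B * y + C := by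
  have h1 : -(|B| * |y|) ≤ B * y := by rw [← abs_mul]; exact neg_abs_le _
  have h2 := mul_le_mul_of_nonneg_right hB (abs_nonneg y)
  have h3 := mul_nonneg (mul_nonneg (neg_nonneg.2 hA) (abs_nonneg y)) (sub_nonneg.2 hy)
  rw [← sq_abs y]
  nlinarith

/-- Pointwise bound of `φ = F σ` and its derivatives in terms of those of `σ`, for `0 ≤ F ≤ M`,
`|F'| ≤ M` and `|F''| ≤ M`. -/
lemma norm_sq_product_le {M F F₁ F₂ ξ : ℝ} (hF : 0 ≤ F) (hFM : F ≤ M) (hF₁ : |F₁| ≤ M)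
    (hF₂ : |F₂| ≤ M) (s s₁ s₂ : ℂ) :
    ‖s₁‖ ^ 2 + ξ ^ 2 * ‖s‖ ^ 2 + ‖(F₂ : ℂ) * s + 2 * F₁ * s₁ + F * s₂‖ ^ 2
        + 2 * ξ ^ 2 * ‖(F₁ : ℂ) * s + F * s₁‖ ^ 2 + ξ ^ 4 * ‖(F : ℂ) * s‖ ^ 2
      ≤ 3 * M * (F * (‖s₂‖ ^ 2 + 2 * ξ ^ 2 * ‖s₁‖ ^ 2 + ξ ^ 4 * ‖s‖ ^ 2))
        + ((1 + 12 * M ^ 2) * ‖s₁‖ ^ 2 + ((1 + 4 * M ^ 2) * ξ ^ 2 + 3 * M ^ 2) * ‖s‖ ^ 2) := by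
  have hM : 0 ≤ M := hF.trans hFM
  have hFF : F ^ 2 ≤ M * F := by nlinarith
  have h1 : F₁ ^ 2 ≤ M ^ 2 := sq_le_sq' (abs_le.1 hF₁).1 (abs_le.1 hF₁).2
  have h2 : F₂ ^ 2 ≤ M ^ 2 := sq_le_sq' (abs_le.1 hF₂).1 (abs_le.1 hF₂).2
  have e0 : ‖(F : ℂ) * s‖ ^ 2 = F ^ 2 * ‖s‖ ^ 2 := by simp [mul_pow]
  have e1 : ‖(F₁ : ℂ) * s + F * s₁‖ ^ 2 ≤ 2 * (F₁ ^ 2 * ‖s‖ ^ 2 + F ^ 2 * ‖s₁‖ ^ 2) := by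
    refine (pow_le_pow_left₀ (norm_nonneg _) (norm_add_le _ _) 2).trans ?_
    simp only [norm_mul, Complex.norm_real, Real.norm_eq_abs]
    rw [← sq_abs F₁, ← sq_abs F]
    nlinarith [sq_nonneg (|F₁| * ‖s‖ - |F| * ‖s₁‖)]
  have e2 : ‖(F₂ : ℂ) * s + 2 * F₁ * s₁ + F * s₂‖ ^ 2
      ≤ 3 * (F₂ ^ 2 * ‖s‖ ^ 2 + 4 * F₁ ^ 2 * ‖s₁‖ ^ 2 + F ^ 2 * ‖s₂‖ ^ 2) := by
    refine (pow_le_pow_left₀ (norm_nonneg _) norm_add₃_le 2).trans ?_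
    simp only [norm_mul, Complex.norm_real, Real.norm_eq_abs, Complex.norm_ofNat]
    rw [← sq_abs F₁, ← sq_abs F, ← sq_abs F₂]
    nlinarith [sq_nonneg (|F₂| * ‖s‖ - 2 * |F₁| * ‖s₁‖), sq_nonneg (|F₂| * ‖s‖ - |F| * ‖s₂‖),
      sq_nonneg (2 * |F₁| * ‖s₁‖ - |F| * ‖s₂‖)]
  have a0 := mul_le_mul_of_nonneg_right hFF (sq_nonneg ‖s‖)
  have a1 := mul_le_mul_of_nonneg_right hFF (sq_nonneg ‖s₁‖)
  have a2 := mul_le_mul_of_nonneg_right hFF (sq_nonneg ‖s₂‖)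
  have b0 := mul_le_mul_of_nonneg_right h1 (sq_nonneg ‖s‖)
  have b1 := mul_le_mul_of_nonneg_right h1 (sq_nonneg ‖s₁‖)
  have b2 := mul_le_mul_of_nonneg_right h2 (sq_nonneg ‖s‖)
  have hMF := mul_nonneg hM hF
  have k1 : 2 * ξ ^ 2 * ‖(F₁ : ℂ) * s + F * s₁‖ ^ 2
      ≤ 2 * ξ ^ 2 * (2 * (M ^ 2 * ‖s‖ ^ 2 + M * F * ‖s₁‖ ^ 2)) :=
    mul_le_mul_of_nonneg_left (by linarith) (by positivity)
  have k0 : ξ ^ 4 * ‖(F : ℂ) * s‖ ^ 2 ≤ ξ ^ 4 * (M * F * ‖s‖ ^ 2) :=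
    mul_le_mul_of_nonneg_left (by linarith) (by positivity)
  have p1 : 0 ≤ ξ ^ 2 * (M * F * ‖s₁‖ ^ 2) := by positivity
  have p0 : 0 ≤ ξ ^ 4 * (M * F * ‖s‖ ^ 2) := by positivity
  nlinarith

/-- The weighted Poincaré-type inequality (Lemma 3.2 of the paper): under condition (ABC)
there is a constant `c > 0` depending only on `A, B, C` such that for every `ξ ∈ ℝ` and every
`C²` function `σ` vanishing at `±1`, with `φ = F·σ` where `F(y) = 3Ay² + By + C`,
the quadratic form
`−12A∫|σ'|² − 6Aξ²∫|σ|² + ∫F(|σ''|² + 2ξ²|σ'|² + ξ⁴|σ|²)`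
dominates `c·∫(|σ'|² + ξ²|σ|² + |φ''|² + 2ξ²|φ'|² + ξ⁴|φ|²)`. -/
theorem stmt_2 (A B C : ℝ) (hABC : (A, B, C) ≠ (0, 0, 0)) (hA : A ≤ 0)
    (hB : |B| ≤ 3 * A + C) :
    ∃ c > 0, ∀ (ξ : ℝ) (σ : ℝ → ℂ), ContDiff ℝ 2 σ → σ (-1) = 0 → σ 1 = 0 →
      c * ∫ y in (-1 : ℝ)..1,
            (‖deriv σ y‖ ^ 2 + ξ ^ 2 * ‖σ y‖ ^ 2
              + ‖iteratedDeriv 2 (fun t => ((3 * A * t ^ 2 + B * t + C : ℝ) : ℂ) * σ t) y‖ ^ 2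
              + 2 * ξ ^ 2 * ‖deriv (fun t => ((3 * A * t ^ 2 + B * t + C : ℝ) : ℂ) * σ t) y‖ ^ 2
              + ξ ^ 4 * ‖((3 * A * y ^ 2 + B * y + C : ℝ) : ℂ) * σ y‖ ^ 2)
        ≤ (-12) * A * (∫ y in (-1 : ℝ)..1, ‖deriv σ y‖ ^ 2)
            + (-6) * A * ξ ^ 2 * (∫ y in (-1 : ℝ)..1, ‖σ y‖ ^ 2)
            + ∫ y in (-1 : ℝ)..1, (3 * A * y ^ 2 + B * y + C) *
                (‖iteratedDeriv 2 σ y‖ ^ 2 + 2 * ξ ^ 2 * ‖deriv σ y‖ ^ 2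
                  + ξ ^ 4 * ‖σ y‖ ^ 2) := by
  have hC0 : 0 ≤ C := by linarith [abs_nonneg B]
  have hC : 0 < C := by
    refine hC0.lt_of_ne fun h => hABC ?_
    have hA0 : A = 0 := by linarith [abs_nonneg B]
    have hB0 : B = 0 := abs_eq_zero.1 (le_antisymm (by linarith) (abs_nonneg B))
    rw [hA0, hB0, ← h]
  obtain ⟨M, hM⟩ : ∃ M, M = 6 * -A + |B| + C := ⟨_, rfl⟩
  have hM0 : 0 < M := by linarith [abs_nonneg B]
  obtain ⟨K, hK⟩ : ∃ K, K = 3 * M + (1 + 12 * M ^ 2) * (4 / C)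
      + (1 + 4 * M ^ 2) * (5 / C) + 3 * M ^ 2 * (8 / C) := ⟨_, rfl⟩
  have hK0 : 0 < K := by rw [hK]; positivity
  refine ⟨K⁻¹, inv_pos.2 hK0, fun ξ σ hσ hl hr => ?_⟩
  have hσ' : ContDiff ℝ 1 (deriv σ) := hσ.deriv'
  have h1 : ∀ y, HasDerivAt σ (deriv σ y) y := fun y =>
    (hσ.differentiable (by norm_num) y).hasDerivAt
  have i2 : iteratedDeriv 2 σ = deriv (deriv σ) := by
    rw [iteratedDeriv_succ, iteratedDeriv_one]
  have h2 : ∀ y, HasDerivAt (deriv σ) (iteratedDeriv 2 σ y) y := fun y => by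
    rw [i2]
    exact (hσ'.differentiable (by norm_num) y).hasDerivAt
  have hc0 : Continuous σ := hσ.continuous
  have hc1 : Continuous (deriv σ) := hσ'.continuous
  have hc2 : Continuous (iteratedDeriv 2 σ) := hσ.continuous_iteratedDeriv 2 le_rfl
  have hF₁ : ∀ y : ℝ, HasDerivAt (fun t : ℝ => ((3 * A * t ^ 2 + B * t + C : ℝ) : ℂ))
      ((6 * A * y + B : ℝ) : ℂ) y := fun y => by
    refine HasDerivAt.ofReal_comp ?_
    refine ((((hasDerivAt_pow 2 y).const_mul (3 * A)).add
      ((hasDerivAt_id y).const_mul B)).add_const C).congr_deriv ?_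
    push_cast
    ring
  have hF₂ : ∀ y : ℝ, HasDerivAt (fun t : ℝ => ((6 * A * t + B : ℝ) : ℂ)) ((6 * A : ℝ) : ℂ) y :=
    fun y => by
      refine HasDerivAt.ofReal_comp ?_
      simpa using ((hasDerivAt_id y).const_mul (6 * A)).add_const B
  have hφ₁ : deriv (fun t => ((3 * A * t ^ 2 + B * t + C : ℝ) : ℂ) * σ t)
      = fun y => ((6 * A * y + B : ℝ) : ℂ) * σ y
        + ((3 * A * y ^ 2 + B * y + C : ℝ) : ℂ) * deriv σ y :=
    funext fun y => ((hF₁ y).mul (h1 y)).deriv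
  have hφ₂ : iteratedDeriv 2 (fun t => ((3 * A * t ^ 2 + B * t + C : ℝ) : ℂ) * σ t)
      = fun y => ((6 * A : ℝ) : ℂ) * σ y + 2 * ((6 * A * y + B : ℝ) : ℂ) * deriv σ y
        + ((3 * A * y ^ 2 + B * y + C : ℝ) : ℂ) * iteratedDeriv 2 σ y := by
    rw [iteratedDeriv_succ, iteratedDeriv_one, hφ₁]
    funext y
    refine (((hF₂ y).mul (h1 y)).add ((hF₁ y).mul (h2 y))).deriv.trans ?_
    ring
  have hD := integral_norm_deriv_sq_le h1 h2 hc2 hl hr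
  have hS := integral_norm_sq_le_of_eq_zero_endpoints h1 hc1 hl hr
  have hξ := sq_mul_integral_norm_sq_le h1 hc1 hl hr ξ
  have hD0 : 0 ≤ ∫ y in (-1 : ℝ)..1, ‖deriv σ y‖ ^ 2 :=
    integral_nonneg (by norm_num) fun y _ => sq_nonneg _
  have hS0 : 0 ≤ ∫ y in (-1 : ℝ)..1, ‖σ y‖ ^ 2 :=
    integral_nonneg (by norm_num) fun y _ => sq_nonneg _
  have hI0 : 0 ≤ ∫ y in (-1 : ℝ)..1, (1 - |y|) * ‖σ y‖ ^ 2 :=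
    integral_nonneg (by norm_num) fun y hy =>
      mul_nonneg (sub_nonneg.2 (abs_le.2 hy)) (sq_nonneg _)
  have hI2 : 0 ≤ ∫ y in (-1 : ℝ)..1, (1 - |y|) * ‖iteratedDeriv 2 σ y‖ ^ 2 :=
    integral_nonneg (by norm_num) fun y hy =>
      mul_nonneg (sub_nonneg.2 (abs_le.2 hy)) (sq_nonneg _)
  have hlow : ∫ y in (-1 : ℝ)..1, (C * ((1 - |y|) * ‖iteratedDeriv 2 σ y‖ ^ 2)
        + C * ξ ^ 4 * ((1 - |y|) * ‖σ y‖ ^ 2))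
      ≤ ∫ y in (-1 : ℝ)..1, (3 * A * y ^ 2 + B * y + C) *
          (‖iteratedDeriv 2 σ y‖ ^ 2 + 2 * ξ ^ 2 * ‖deriv σ y‖ ^ 2 + ξ ^ 4 * ‖σ y‖ ^ 2) := by
    refine integral_mono_on (by norm_num) (Continuous.intervalIntegrable (by fun_prop) _ _)
      (Continuous.intervalIntegrable (by fun_prop) _ _) fun y hy => ?_
    have hy' := abs_le.2 hy
    have hF := quadratic_ge_mul_one_sub_abs hA hB hy'
    have hF0 := mul_nonneg hC0 (sub_nonneg.2 hy')
    refine le_trans ?_ (mul_le_mul_of_nonneg_right hF (by positivity))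
    have : 0 ≤ C * (1 - |y|) * (2 * ξ ^ 2 * ‖deriv σ y‖ ^ 2) := mul_nonneg hF0 (by positivity)
    linarith
  rw [integral_add (Continuous.intervalIntegrable (by fun_prop) _ _)
    (Continuous.intervalIntegrable (by fun_prop) _ _), intervalIntegral.integral_const_mul,
    intervalIntegral.integral_const_mul] at hlow
  have hup : ∫ y in (-1 : ℝ)..1,
        (‖deriv σ y‖ ^ 2 + ξ ^ 2 * ‖σ y‖ ^ 2
          + ‖iteratedDeriv 2 (fun t => ((3 * A * t ^ 2 + B * t + C : ℝ) : ℂ) * σ t) y‖ ^ 2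
          + 2 * ξ ^ 2 * ‖deriv (fun t => ((3 * A * t ^ 2 + B * t + C : ℝ) : ℂ) * σ t) y‖ ^ 2
          + ξ ^ 4 * ‖((3 * A * y ^ 2 + B * y + C : ℝ) : ℂ) * σ y‖ ^ 2)
      ≤ ∫ y in (-1 : ℝ)..1, (3 * M * ((3 * A * y ^ 2 + B * y + C) *
          (‖iteratedDeriv 2 σ y‖ ^ 2 + 2 * ξ ^ 2 * ‖deriv σ y‖ ^ 2 + ξ ^ 4 * ‖σ y‖ ^ 2))
        + ((1 + 12 * M ^ 2) * ‖deriv σ y‖ ^ 2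
          + ((1 + 4 * M ^ 2) * ξ ^ 2 + 3 * M ^ 2) * ‖σ y‖ ^ 2)) := by
    rw [hφ₁, hφ₂]
    refine integral_mono_on (by norm_num) (Continuous.intervalIntegrable (by fun_prop) _ _)
      (Continuous.intervalIntegrable (by fun_prop) _ _) fun y hy => ?_
    have hy' := abs_le.2 hy
    have hBy : |B * y| ≤ |B| := by
      rw [abs_mul]; exact mul_le_of_le_one_right (abs_nonneg B) hy'
    have hAy : |6 * A * y| ≤ 6 * -A := by
      rw [abs_mul, abs_of_nonpos (by linarith : 6 * A ≤ 0)]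
      nlinarith
    refine norm_sq_product_le ?_ ?_ ?_ ?_ _ _ _
    · exact (mul_nonneg hC0 (sub_nonneg.2 hy')).trans (quadratic_ge_mul_one_sub_abs hA hB hy')
    · nlinarith [le_abs_self (B * y), mul_nonneg (neg_nonneg.2 hA) (sq_nonneg y)]
    · exact (abs_add_le _ _).trans (by linarith)
    · rw [abs_of_nonpos (by linarith)]
      linarith [abs_nonneg B]
  rw [inv_mul_le_iff₀ hK0]
  refine hup.trans ?_
  rw [integral_add (Continuous.intervalIntegrable (by fun_prop) _ _)
    (Continuous.intervalIntegrable (by fun_prop) _ _),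
    integral_add (Continuous.intervalIntegrable (by fun_prop) _ _)
    (Continuous.intervalIntegrable (by fun_prop) _ _), intervalIntegral.integral_const_mul,
    intervalIntegral.integral_const_mul, intervalIntegral.integral_const_mul]
  have hξ4 := mul_nonneg (by positivity : 0 ≤ ξ ^ 4) hI0
  have hAD := mul_nonneg (neg_nonneg.2 hA) hD0
  have hAS := mul_nonneg (neg_nonneg.2 hA) (mul_nonneg (sq_nonneg ξ) hS0)
  set L := ∫ y in (-1 : ℝ)..1, (3 * A * y ^ 2 + B * y + C) *
    (‖iteratedDeriv 2 σ y‖ ^ 2 + 2 * ξ ^ 2 * ‖deriv σ y‖ ^ 2 + ξ ^ 4 * ‖σ y‖ ^ 2)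
  set D := ∫ y in (-1 : ℝ)..1, ‖deriv σ y‖ ^ 2
  set S := ∫ y in (-1 : ℝ)..1, ‖σ y‖ ^ 2
  set I₂ := ∫ y in (-1 : ℝ)..1, (1 - |y|) * ‖iteratedDeriv 2 σ y‖ ^ 2
  set I₀ := ∫ y in (-1 : ℝ)..1, (1 - |y|) * ‖σ y‖ ^ 2
  have hsum : I₂ + ξ ^ 4 * I₀ ≤ L / C := by
    rw [le_div_iff₀ hC]
    linarith
  have kD : (1 + 12 * M ^ 2) * D ≤ (1 + 12 * M ^ 2) * (4 * (L / C)) :=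
    mul_le_mul_of_nonneg_left (by linarith) (by positivity)
  have kξ : (1 + 4 * M ^ 2) * (ξ ^ 2 * S) ≤ (1 + 4 * M ^ 2) * (5 * (L / C)) :=
    mul_le_mul_of_nonneg_left (by linarith) (by positivity)
  have kS : 3 * M ^ 2 * S ≤ 3 * M ^ 2 * (8 * (L / C)) :=
    mul_le_mul_of_nonneg_left (by linarith) (by positivity)
  have hKL : K * L = 3 * M * L + (1 + 12 * M ^ 2) * (4 * (L / C))
      + (1 + 4 * M ^ 2) * (5 * (L / C)) + 3 * M ^ 2 * (8 * (L / C)) := by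
    rw [hK]; ring
  refine le_trans (b := K * L) (by linarith) (mul_le_mul_of_nonneg_left (by linarith) hK0.le)
end

section
/- Let A, B, C satisfy condition (ABC) and F(y) = 3Ay² + By + C. There exists a constant c > 0 depending only on A, B, C such that for every ξ ≠ 0, every continuous h : [-1,1] → ℂ, and every C⁴ solution φ : [-1,1] → ℂ of the Orr–Sommerfeld problem φ'''' − 2ξ²φ'' + ξ⁴φ − iξ[F(y)(φ'' − ξ²φ) − 6Aφ] = h on (-1,1) with φ(±1) = φ'(±1) = 0, one has ∫₋₁¹(|φ''(y)|² + 2ξ²|φ'(y)|² + ξ⁴|φ(y)|²)dy ≤ c·ξ⁻²·∫₋₁¹|h(y)|²dy. -/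
open MeasureTheory intervalIntegral

/-- A function dominated by another one up to the derivative of a function with equal values at
`±1` has the smaller integral over `[-1, 1]`. -/
theorem integral_le_of_le_add_deriv {u v W w : ℝ → ℝ} (hu : Continuous u) (hv : Continuous v)
    (hW : ∀ y ∈ Set.Icc (-1 : ℝ) 1, HasDerivAt W (w y) y) (hb : W 1 = W (-1))
    (hle : ∀ y ∈ Set.Icc (-1 : ℝ) 1, u y ≤ v y + w y) :
    ∫ y in (-1 : ℝ)..1, u y ≤ ∫ y in (-1 : ℝ)..1, v y := by
  have key := sub_le_integral_of_hasDeriv_right_of_le (g := fun y => -W y)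
    (g' := fun y => -w y) (φ := fun y => v y - u y) (a := (-1 : ℝ)) (b := 1) (by norm_num)
    (fun y hy => (hW y hy).neg.continuousAt.continuousWithinAt)
    (fun y hy => (hW y (Set.Ioo_subset_Icc_self hy)).neg.hasDerivWithinAt)
    ((hv.sub hu).continuousOn.integrableOn_Icc)
    (fun y hy => by linarith [hle y (Set.Ioo_subset_Icc_self hy)])
  rw [integral_sub (hv.intervalIntegrable _ _) (hu.intervalIntegrable _ _)] at key
  linarith

/-- Real and imaginary parts `a k + i b k` of the derivatives of a solution of the Orr–Sommerfeld
problem with datum `r + i s`. -/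
structure OrrSommerfeldJet (A B C ξ : ℝ) (a b : ℕ → ℝ → ℝ) (r s : ℝ → ℝ) : Prop where
  continuous_re : ∀ k ≤ 4, Continuous (a k)
  continuous_im : ∀ k ≤ 4, Continuous (b k)
  hasDerivAt_re : ∀ k < 4, ∀ y, HasDerivAt (a k) (a (k + 1) y) y
  hasDerivAt_im : ∀ k < 4, ∀ y, HasDerivAt (b k) (b (k + 1) y) y
  eq_re : ∀ y, r y = a 4 y - 2 * ξ ^ 2 * a 2 y + ξ ^ 4 * a 0 y
    + ξ * ((3 * A * y ^ 2 + B * y + C) * (b 2 y - ξ ^ 2 * b 0 y) - 6 * A * b 0 y)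
  eq_im : ∀ y, s y = b 4 y - 2 * ξ ^ 2 * b 2 y + ξ ^ 4 * b 0 y
    - ξ * ((3 * A * y ^ 2 + B * y + C) * (a 2 y - ξ ^ 2 * a 0 y) - 6 * A * a 0 y)
  re_left : ∀ k < 2, a k (-1) = 0
  re_right : ∀ k < 2, a k 1 = 0
  im_left : ∀ k < 2, b k (-1) = 0
  im_right : ∀ k < 2, b k 1 = 0

namespace OrrSommerfeldJet

variable {A B C ξ : ℝ} {a b : ℕ → ℝ → ℝ} {r s : ℝ → ℝ}

theorem continuous_datum_re (H : OrrSommerfeldJet A B C ξ a b r s) : Continuous r := by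
  have := H.continuous_re 0 (by norm_num)
  have := H.continuous_re 2 (by norm_num)
  have := H.continuous_re 4 (by norm_num)
  have := H.continuous_im 0 (by norm_num)
  have := H.continuous_im 2 (by norm_num)
  rw [funext H.eq_re]
  fun_prop

theorem continuous_datum_im (H : OrrSommerfeldJet A B C ξ a b r s) : Continuous s := by
  have := H.continuous_im 0 (by norm_num)
  have := H.continuous_im 2 (by norm_num)
  have := H.continuous_im 4 (by norm_num)
  have := H.continuous_re 0 (by norm_num)
  have := H.continuous_re 2 (by norm_num)
  rw [funext H.eq_im]
  fun_prop

/-- The energy density `|φ''|² + 2ξ²|φ'|² + ξ⁴|φ|²`. -/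
def energy (ξ : ℝ) (a b : ℕ → ℝ → ℝ) (y : ℝ) : ℝ :=
  (a 2 y ^ 2 + b 2 y ^ 2) + 2 * ξ ^ 2 * (a 1 y ^ 2 + b 1 y ^ 2)
    + ξ ^ 4 * (a 0 y ^ 2 + b 0 y ^ 2)

theorem continuous_energy (H : OrrSommerfeldJet A B C ξ a b r s) :
    Continuous (energy ξ a b) := by
  have := H.continuous_re 0 (by norm_num)
  have := H.continuous_re 1 (by norm_num)
  have := H.continuous_re 2 (by norm_num)
  have := H.continuous_im 0 (by norm_num)
  have := H.continuous_im 1 (by norm_num)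
  have := H.continuous_im 2 (by norm_num)
  unfold energy
  fun_prop

theorem continuous_normSq (H : OrrSommerfeldJet A B C ξ a b r s) {k : ℕ} (hk : k ≤ 4) :
    Continuous fun y => a k y ^ 2 + b k y ^ 2 :=
  ((H.continuous_re k hk).pow 2).add ((H.continuous_im k hk).pow 2)

theorem continuous_datum_normSq (H : OrrSommerfeldJet A B C ξ a b r s) :
    Continuous fun y => r y ^ 2 + s y ^ 2 :=
  (H.continuous_datum_re.pow 2).add (H.continuous_datum_im.pow 2)

theorem hasDerivAt_profile (A B C y : ℝ) :
    HasDerivAt (fun y : ℝ => 3 * A * y ^ 2 + B * y + C) (6 * A * y + B) y := by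
  have h := ((((hasDerivAt_id y).pow 2).const_mul (3 * A)).add
    ((hasDerivAt_id y).const_mul B)).add_const C
  refine h.congr_deriv ?_
  simp only [id]
  ring

/-- The boundary term in the energy identity. -/
def energyFlux (A B C ξ : ℝ) (a b : ℕ → ℝ → ℝ) (y : ℝ) : ℝ :=
  (a 3 y * a 0 y - a 2 y * a 1 y) + (b 3 y * b 0 y - b 2 y * b 1 y)
    - 2 * ξ ^ 2 * (a 1 y * a 0 y + b 1 y * b 0 y)
    + ξ * ((3 * A * y ^ 2 + B * y + C) * (b 1 y * a 0 y - a 1 y * b 0 y))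

theorem hasDerivAt_energyFlux (H : OrrSommerfeldJet A B C ξ a b r s) (y : ℝ) :
    HasDerivAt (energyFlux A B C ξ a b)
      (r y * a 0 y + s y * b 0 y
        + ξ * ((6 * A * y + B) * (b 1 y * a 0 y - a 1 y * b 0 y)) - energy ξ a b y) y := by
  have a0 := H.hasDerivAt_re 0 (by norm_num) y
  have a1 := H.hasDerivAt_re 1 (by norm_num) y
  have a2 := H.hasDerivAt_re 2 (by norm_num) y
  have a3 := H.hasDerivAt_re 3 (by norm_num) y
  have b0 := H.hasDerivAt_im 0 (by norm_num) y
  have b1 := H.hasDerivAt_im 1 (by norm_num) y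
  have b2 := H.hasDerivAt_im 2 (by norm_num) y
  have b3 := H.hasDerivAt_im 3 (by norm_num) y
  have h := ((((a3.mul a0).sub (a2.mul a1)).add ((b3.mul b0).sub (b2.mul b1))).sub
    (((a1.mul a0).add (b1.mul b0)).const_mul (2 * ξ ^ 2))).add
    (((hasDerivAt_profile A B C y).mul ((b1.mul a0).sub (a1.mul b0))).const_mul ξ)
  refine h.congr_deriv ?_
  simp only [energy, H.eq_re, H.eq_im, Pi.sub_apply, Pi.mul_apply]
  ring

theorem energyFlux_eq (H : OrrSommerfeldJet A B C ξ a b r s) :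
    energyFlux A B C ξ a b 1 = energyFlux A B C ξ a b (-1) := by
  simp [energyFlux, H.re_left, H.re_right, H.im_left, H.im_right]

theorem deriv_profile_sq_le (A B : ℝ) {y : ℝ} (hy : y ∈ Set.Icc (-1 : ℝ) 1) :
    (6 * A * y + B) ^ 2 ≤ (6 * |A| + |B|) ^ 2 := by
  rw [sq_le_sq, abs_of_nonneg (a := 6 * |A| + |B|) (by positivity)]
  have h1 : |y| ≤ 1 := abs_le.2 hy
  calc |6 * A * y + B| ≤ |6 * A * y| + |B| := abs_add_le _ _
    _ = 6 * |A| * |y| + |B| := by simp [abs_mul]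
    _ ≤ 6 * |A| + |B| := by nlinarith [abs_nonneg A]

/-- Energy bound for high frequencies. -/
theorem integral_energy_le_of_large (H : OrrSommerfeldJet A B C ξ a b r s)
    (hξ : 6 * |A| + |B| + 1 ≤ ξ ^ 2) :
    ∫ y in (-1 : ℝ)..1, energy ξ a b y
      ≤ 2 / ξ ^ 4 * ∫ y in (-1 : ℝ)..1, (r y ^ 2 + s y ^ 2) := by
  have hM : 0 ≤ 6 * |A| + |B| := by positivity
  have hξ0 : ξ ≠ 0 := by
    rintro rfl
    norm_num at hξ
    linarith
  have hξ4 : 0 < ξ ^ 4 := by positivity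
  rw [← intervalIntegral.integral_const_mul]
  refine integral_le_of_le_add_deriv H.continuous_energy
    (H.continuous_datum_normSq.const_mul _) (fun y _ => (H.hasDerivAt_energyFlux y).const_mul (-2))
    (by rw [H.energyFlux_eq]) (fun y hy => ?_)
  have hF := deriv_profile_sq_le A B hy
  have hF' : (6 * A * y + B) ^ 2 ≤ ξ ^ 4 := by nlinarith
  set t := 6 * A * y + B
  have young : ∀ u v : ℝ, u * v ≤ 1 / ξ ^ 4 * u ^ 2 + ξ ^ 4 / 4 * v ^ 2 := by
    intro u v
    have : 0 ≤ (1 / ξ ^ 4) * (u - ξ ^ 4 / 2 * v) ^ 2 := by positivity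
    have e : (1 / ξ ^ 4) * (u - ξ ^ 4 / 2 * v) ^ 2
        = 1 / ξ ^ 4 * u ^ 2 + ξ ^ 4 / 4 * v ^ 2 - u * v := by
      field_simp
      ring
    linarith
  have shear : ∀ u v : ℝ, ξ * (t * (u * v)) ≤ ξ ^ 2 * u ^ 2 + ξ ^ 4 / 4 * v ^ 2 := by
    intro u v
    have := mul_le_mul_of_nonneg_right hF' (sq_nonneg v)
    nlinarith [sq_nonneg (ξ * u - t * v / 2)]
  have e1 := young (r y) (a 0 y)
  have e2 := young (s y) (b 0 y)
  have e3 := shear (b 1 y) (a 0 y)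
  have e4 := shear (-a 1 y) (b 0 y)
  have e5 : 2 / ξ ^ 4 * (r y ^ 2 + s y ^ 2)
      = 2 * (1 / ξ ^ 4 * r y ^ 2) + 2 * (1 / ξ ^ 4 * s y ^ 2) := by ring
  rw [e5]
  unfold energy
  nlinarith [sq_nonneg (a 2 y), sq_nonneg (b 2 y)]

/-- Energy bound in terms of the datum and of the `L²` norm of the solution. -/
theorem integral_energy_le_add (H : OrrSommerfeldJet A B C ξ a b r s) :
    ∫ y in (-1 : ℝ)..1, energy ξ a b y
      ≤ (∫ y in (-1 : ℝ)..1, (r y ^ 2 + s y ^ 2))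
        + (1 + 4 * ξ ^ 2 * (6 * |A| + |B|) ^ 2)
          * ∫ y in (-1 : ℝ)..1, (a 0 y ^ 2 + b 0 y ^ 2) := by
  have hr := H.continuous_datum_normSq
  have h0 := H.continuous_normSq (k := 0) (by norm_num)
  rw [← intervalIntegral.integral_const_mul,
    ← integral_add (hr.intervalIntegrable _ _) ((h0.const_mul _).intervalIntegrable _ _)]
  have hW : ∀ y ∈ Set.Icc (-1 : ℝ) 1, HasDerivAt
      (fun y => -2 * energyFlux A B C ξ a b y + 1 / 2 * (y * (a 1 y ^ 2 + b 1 y ^ 2)))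
      (-2 * (r y * a 0 y + s y * b 0 y
        + ξ * ((6 * A * y + B) * (b 1 y * a 0 y - a 1 y * b 0 y)) - energy ξ a b y)
        + 1 / 2 * ((a 1 y ^ 2 + b 1 y ^ 2)
          + y * (2 * a 1 y * a 2 y + 2 * b 1 y * b 2 y))) y := by
    intro y _
    have h := ((H.hasDerivAt_energyFlux y).const_mul (-2)).add
      (((hasDerivAt_id y).mul (((H.hasDerivAt_re 1 (by norm_num) y).pow 2).add
        ((H.hasDerivAt_im 1 (by norm_num) y).pow 2))).const_mul (1 / 2))
    refine h.congr_deriv ?_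
    simp
  refine integral_le_of_le_add_deriv H.continuous_energy (hr.add (h0.const_mul _)) hW
    ?_ (fun y hy => ?_)
  · simp [H.energyFlux_eq, H.re_left, H.re_right, H.im_left, H.im_right]
  have hF := deriv_profile_sq_le A B hy
  set M := 6 * |A| + |B|
  set t := 6 * A * y + B
  have shear : ∀ u v : ℝ, ξ * (t * (u * v)) ≤ u ^ 2 / 8 + 2 * (ξ ^ 2 * M ^ 2 * v ^ 2) := by
    intro u v
    have := mul_le_mul_of_nonneg_right hF (sq_nonneg (ξ * v))
    nlinarith [sq_nonneg (u / 4 - t * (ξ * v))]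
  have hy2 : y ^ 2 ≤ 1 := by nlinarith [hy.1, hy.2]
  have poincare : ∀ u v : ℝ, -(y * (u * v)) ≤ u ^ 2 / 4 + v ^ 2 := by
    intro u v
    have := mul_le_mul_of_nonneg_right hy2 (sq_nonneg v)
    nlinarith [sq_nonneg (u / 2 + y * v)]
  have e1 := shear (b 1 y) (a 0 y)
  have e2 := shear (-a 1 y) (b 0 y)
  have e3 := poincare (a 1 y) (a 2 y)
  have e4 := poincare (b 1 y) (b 2 y)
  have e5 := sq_nonneg (r y - a 0 y)
  have e6 := sq_nonneg (s y - b 0 y)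
  have e7 : 0 ≤ ξ ^ 2 * (a 1 y ^ 2 + b 1 y ^ 2) := by positivity
  have e8 : 0 ≤ ξ ^ 4 * (a 0 y ^ 2 + b 0 y ^ 2) := by positivity
  unfold energy
  nlinarith

/-- Frequency-dependent `L²` bound for a linear profile. -/
theorem integral_normSq_le_of_linear (H : OrrSommerfeldJet 0 B C ξ a b r s) (hC : 0 < C)
    (hB : |B| ≤ C) (hξ : ξ ≠ 0) :
    ∫ y in (-1 : ℝ)..1, (a 0 y ^ 2 + b 0 y ^ 2)
      ≤ 256 / (C ^ 2 * ξ ^ 2) * ∫ y in (-1 : ℝ)..1, (r y ^ 2 + s y ^ 2) := by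
  obtain ⟨σ, hσ, hσF⟩ : ∃ σ : ℝ, σ ^ 2 = 1 ∧
      ∀ y ∈ Set.Icc (-1 : ℝ) 1, C * (1 + σ * y) ≤ 2 * (B * y + C) := by
    obtain ⟨hB1, hB2⟩ := abs_le.1 hB
    rcases le_total 0 B with h | h
    · exact ⟨1, by norm_num, fun y hy => by nlinarith [hy.1, hy.2]⟩
    · exact ⟨-1, by norm_num, fun y hy => by nlinarith [hy.1, hy.2]⟩
  have hσ1 : |σ| = 1 := by rwa [← sq_eq_sq₀ (abs_nonneg σ) zero_le_one, sq_abs, one_pow]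
  rw [← intervalIntegral.integral_const_mul]
  have hW : ∀ y ∈ Set.Icc (-1 : ℝ) 1, HasDerivAt
      (fun y => 4 * σ * ((1 + σ * y) * (a 0 y ^ 2 + b 0 y ^ 2))
        - 32 / (C * ξ) * ((b 3 y * a 0 y - b 2 y * a 1 y) - (a 3 y * b 0 y - a 2 y * b 1 y)
          - 2 * ξ ^ 2 * (b 1 y * a 0 y - a 1 y * b 0 y)
          - ξ * ((3 * 0 * y ^ 2 + B * y + C) * (a 1 y * a 0 y + b 1 y * b 0 y))
          + ξ * B / 2 * (a 0 y ^ 2 + b 0 y ^ 2)))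
      (4 * σ * (σ * (a 0 y ^ 2 + b 0 y ^ 2)
          + (1 + σ * y) * (2 * a 0 y * a 1 y + 2 * b 0 y * b 1 y))
        - 32 / (C * ξ) * ((s y * a 0 y - r y * b 0 y)
          - ξ * ((B * y + C) * ((a 1 y ^ 2 + b 1 y ^ 2) + ξ ^ 2 * (a 0 y ^ 2 + b 0 y ^ 2))))) y := by
    intro y _
    have a0 := H.hasDerivAt_re 0 (by norm_num) y
    have a1 := H.hasDerivAt_re 1 (by norm_num) y
    have a2 := H.hasDerivAt_re 2 (by norm_num) y
    have a3 := H.hasDerivAt_re 3 (by norm_num) y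
    have b0 := H.hasDerivAt_im 0 (by norm_num) y
    have b1 := H.hasDerivAt_im 1 (by norm_num) y
    have b2 := H.hasDerivAt_im 2 (by norm_num) y
    have b3 := H.hasDerivAt_im 3 (by norm_num) y
    have h := ((((((hasDerivAt_id y).const_mul σ).const_add 1).mul
      ((a0.pow 2).add (b0.pow 2)))).const_mul (4 * σ)).sub
      ((((((b3.mul a0).sub (b2.mul a1)).sub ((a3.mul b0).sub (a2.mul b1))).sub
        (((b1.mul a0).sub (a1.mul b0)).const_mul (2 * ξ ^ 2))).sub
        (((hasDerivAt_profile 0 B C y).mul ((a1.mul a0).add (b1.mul b0))).const_mul ξ)).add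
        (((a0.pow 2).add (b0.pow 2)).const_mul (ξ * B / 2)) |>.const_mul (32 / (C * ξ)))
    refine h.congr_deriv ?_
    simp only [H.eq_re, H.eq_im, Pi.add_apply, Pi.mul_apply, Pi.pow_apply, id]
    ring
  refine integral_le_of_le_add_deriv (H.continuous_normSq (k := 0) (by norm_num))
    (H.continuous_datum_normSq.const_mul _) hW ?_ (fun y hy => ?_)
  · simp [H.re_left, H.re_right, H.im_left, H.im_right]
  have hF := hσF y hy
  have hσy : |σ * y| ≤ 1 := by rw [abs_mul, hσ1, one_mul]; exact abs_le.2 hy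
  obtain ⟨h1, h2⟩ := abs_le.1 hσy
  have hρ : 0 ≤ 1 + σ * y := by linarith
  have hFn : 0 ≤ B * y + C := by nlinarith
  have hardy : ∀ u v : ℝ, -(4 * σ * ((1 + σ * y) * (2 * u * v)))
      ≤ u ^ 2 * 2 + 32 / C * ((B * y + C) * v ^ 2) := by
    intro u v
    have e : 0 ≤ (1 + σ * y) * (σ * u + 4 * v) ^ 2 := by positivity
    have e' : (1 + σ * y) * (σ * u + 4 * v) ^ 2
        = (1 + σ * y) * (u ^ 2 + 16 * v ^ 2) + 4 * σ * ((1 + σ * y) * (2 * u * v)) := by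
      linear_combination (1 + σ * y) * u ^ 2 * hσ
    have e2 : (1 + σ * y) * u ^ 2 ≤ 2 * u ^ 2 := by nlinarith [sq_nonneg u]
    have e3 : (1 + σ * y) * (16 * v ^ 2) ≤ 32 / C * ((B * y + C) * v ^ 2) := by
      rw [div_mul_eq_mul_div, le_div_iff₀ hC]
      nlinarith [mul_le_mul_of_nonneg_right hF (sq_nonneg v)]
    linarith
  have young : ∀ u v : ℝ, 32 / (C * ξ) * (u * v) ≤ v ^ 2 + 256 / (C ^ 2 * ξ ^ 2) * u ^ 2 := by
    intro u v
    have e : 0 ≤ (v - 16 / (C * ξ) * u) ^ 2 := sq_nonneg _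
    have e' : (v - 16 / (C * ξ) * u) ^ 2
        = v ^ 2 + 256 / (C ^ 2 * ξ ^ 2) * u ^ 2 - 32 / (C * ξ) * (u * v) := by
      field_simp
      ring
    linarith
  have e1 := hardy (a 0 y) (a 1 y)
  have e2 := hardy (b 0 y) (b 1 y)
  have e3 := young (s y) (a 0 y)
  have e4 := young (-r y) (b 0 y)
  have e5 : 32 / (C * ξ) * (ξ * ((B * y + C) * ((a 1 y ^ 2 + b 1 y ^ 2)
        + ξ ^ 2 * (a 0 y ^ 2 + b 0 y ^ 2))))
      = 32 / C * ((B * y + C) * a 1 y ^ 2) + 32 / C * ((B * y + C) * b 1 y ^ 2)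
        + 32 / C * ((B * y + C) * (ξ ^ 2 * (a 0 y ^ 2 + b 0 y ^ 2))) := by
    field_simp
  have e6 : 0 ≤ 32 / C * ((B * y + C) * (ξ ^ 2 * (a 0 y ^ 2 + b 0 y ^ 2))) := by positivity
  have e7 : 4 * σ * (σ * (a 0 y ^ 2 + b 0 y ^ 2)) = 4 * (a 0 y ^ 2 + b 0 y ^ 2) := by
    linear_combination 4 * (a 0 y ^ 2 + b 0 y ^ 2) * hσ
  rw [mul_add (4 * σ), e7, mul_sub (32 / (C * ξ)), e5]
  linarith

/-- The first two derivatives of a quotient, given the jet of the numerator and the derivatives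
`G'`, `G''` of the denominator `G`. -/
theorem hasDerivAt_div_twice {f f₁ G G' : ℝ → ℝ} {f₂ G'' y : ℝ} (hG : G y ≠ 0)
    (hf : HasDerivAt f (f₁ y) y) (hf₁ : HasDerivAt f₁ f₂ y) (hG₀ : HasDerivAt G (G' y) y)
    (hG₁ : HasDerivAt G' G'' y) :
    HasDerivAt (fun y => f y / G y) ((f₁ y - G' y * (f y / G y)) / G y) y ∧
    HasDerivAt (fun y => (f₁ y - G' y * (f y / G y)) / G y)
      ((f₂ - G'' * (f y / G y) - 2 * G' y * ((f₁ y - G' y * (f y / G y)) / G y)) / G y) y := by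
  have h0 : HasDerivAt (fun y => f y / G y) ((f₁ y - G' y * (f y / G y)) / G y) y := by
    refine (hf.div hG₀ hG).congr_deriv ?_
    field_simp
  refine ⟨h0, ?_⟩
  refine ((hf₁.sub (hG₁.mul h0)).div hG₀ hG).congr_deriv ?_
  simp only [Pi.sub_apply, Pi.mul_apply]
  field_simp
  ring

theorem profile_nonneg (hA : A ≤ 0) (hB : |B| ≤ 3 * A + C) {y : ℝ}
    (hy : y ∈ Set.Icc (-1 : ℝ) 1) : 0 ≤ 3 * A * y ^ 2 + B * y + C := by
  obtain ⟨h1, h2⟩ := abs_le.1 hB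
  have hy2 : y ^ 2 ≤ 1 := by nlinarith [hy.1, hy.2]
  have hBy : -|B| ≤ B * y := by
    have : |B * y| ≤ |B| := by
      rw [abs_mul]
      exact mul_le_of_le_one_right (abs_nonneg B) (abs_le.2 hy)
    linarith [neg_abs_le (B * y)]
  nlinarith

theorem profile_le (hA : A ≤ 0) {y : ℝ} (hy : y ∈ Set.Icc (-1 : ℝ) 1) :
    3 * A * y ^ 2 + B * y + C ≤ |B| + |C| := by
  have hBy : B * y ≤ |B| := by
    refine (le_abs_self _).trans ?_
    rw [abs_mul]
    exact mul_le_of_le_one_right (abs_nonneg B) (abs_le.2 hy)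
  nlinarith [le_abs_self C, sq_nonneg y]

/-- `L²` bound for a strictly concave profile, obtained by testing the equation with the solution
divided by the profile raised by `ε`. -/
theorem integral_normSq_le_add_of_concave (H : OrrSommerfeldJet A B C ξ a b r s) (hA : A < 0)
    (hB : |B| ≤ 3 * A + C) {ε : ℝ} (hε : 0 < ε) (hε1 : ε ≤ 1) :
    -A / (|B| + |C| + 1) ^ 2 * ∫ y in (-1 : ℝ)..1, (a 0 y ^ 2 + b 0 y ^ 2)
      ≤ 1 / (4 * -A) * (∫ y in (-1 : ℝ)..1, (r y ^ 2 + s y ^ 2))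
        + ξ ^ 2 * ε ^ 2 / (4 * -A) * ∫ y in (-1 : ℝ)..1, (a 2 y ^ 2 + b 2 y ^ 2) := by
  have hr := H.continuous_datum_normSq
  have h0 := H.continuous_normSq (k := 0) (by norm_num)
  have h2 := H.continuous_normSq (k := 2) (by norm_num)
  set M := |B| + |C| + 1 with hM
  have hMpos : 0 < M := by positivity
  have hα : 0 < -A := by linarith
  rw [← intervalIntegral.integral_const_mul, ← intervalIntegral.integral_const_mul,
    ← intervalIntegral.integral_const_mul,
    ← integral_add ((hr.const_mul _).intervalIntegrable _ _)
      ((h2.const_mul _).intervalIntegrable _ _)]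
  set G : ℝ → ℝ := fun y => 3 * A * y ^ 2 + B * y + (C + ε) with hG
  set G' : ℝ → ℝ := fun y => 6 * A * y + B with hG'
  set p : ℝ → ℝ := fun y => a 0 y / G y with hp
  set p₁ : ℝ → ℝ := fun y => (a 1 y - G' y * (a 0 y / G y)) / G y with hp₁
  set p₂ : ℝ → ℝ := fun y =>
    (a 2 y - 6 * A * (a 0 y / G y) - 2 * G' y * ((a 1 y - G' y * (a 0 y / G y)) / G y)) / G y
    with hp₂
  set q : ℝ → ℝ := fun y => b 0 y / G y with hq
  set q₁ : ℝ → ℝ := fun y => (b 1 y - G' y * (b 0 y / G y)) / G y with hq₁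
  set q₂ : ℝ → ℝ := fun y =>
    (b 2 y - 6 * A * (b 0 y / G y) - 2 * G' y * ((b 1 y - G' y * (b 0 y / G y)) / G y)) / G y
    with hq₂
  have hGpos : ∀ y ∈ Set.Icc (-1 : ℝ) 1, 0 < G y := fun y hy => by
    have := profile_nonneg hA.le hB hy
    simp only [hG]
    linarith
  have hGle : ∀ y ∈ Set.Icc (-1 : ℝ) 1, G y ≤ M := fun y hy => by
    have := profile_le (B := B) (C := C) hA.le hy
    simp only [hG, hM]
    linarith
  have hG'd : ∀ y, HasDerivAt G' (6 * A) y := fun y => by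
    refine (((hasDerivAt_id y).const_mul (6 * A)).add_const B).congr_deriv ?_
    ring
  have jet_a : ∀ y ∈ Set.Icc (-1 : ℝ) 1,
      a 0 y = G y * p y ∧ a 1 y = G' y * p y + G y * p₁ y ∧
      a 2 y = 6 * A * p y + 2 * G' y * p₁ y + G y * p₂ y := fun y hy => by
    have := (hGpos y hy).ne'
    simp only [hp, hp₁, hp₂]
    refine ⟨by field_simp, by field_simp; ring, by field_simp; ring⟩
  have jet_b : ∀ y ∈ Set.Icc (-1 : ℝ) 1,
      b 0 y = G y * q y ∧ b 1 y = G' y * q y + G y * q₁ y ∧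
      b 2 y = 6 * A * q y + 2 * G' y * q₁ y + G y * q₂ y := fun y hy => by
    have := (hGpos y hy).ne'
    simp only [hq, hq₁, hq₂]
    refine ⟨by field_simp, by field_simp; ring, by field_simp; ring⟩
  have hW : ∀ y ∈ Set.Icc (-1 : ℝ) 1, HasDerivAt
      (fun y => 6 * -A * (y * (p y ^ 2 + q y ^ 2))
        - ((a 3 y * p y - a 2 y * p₁ y) + (b 3 y * q y - b 2 y * q₁ y)
          + G' y * (p₁ y ^ 2 + q₁ y ^ 2) + 6 * A * (p y * p₁ y + q y * q₁ y)
          - 2 * ξ ^ 2 * (a 1 y * p y + b 1 y * q y) + ξ ^ 2 * (G' y * (p y ^ 2 + q y ^ 2))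
          + ξ * (b 1 y * a 0 y - a 1 y * b 0 y)))
      (6 * -A * ((p y ^ 2 + q y ^ 2) + y * (2 * p y * p₁ y + 2 * q y * q₁ y))
        - (r y * p y + s y * q y + ξ * ε * (b 2 y * p y - a 2 y * q y)
          - (G y * (p₂ y ^ 2 + q₂ y ^ 2) - 12 * A * (p₁ y ^ 2 + q₁ y ^ 2)
            + 2 * ξ ^ 2 * (G y * (p₁ y ^ 2 + q₁ y ^ 2) - 3 * A * (p y ^ 2 + q y ^ 2))
            + ξ ^ 4 * (G y * (p y ^ 2 + q y ^ 2))))) y := by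
    intro y hy
    have a0 := H.hasDerivAt_re 0 (by norm_num) y
    have a1 := H.hasDerivAt_re 1 (by norm_num) y
    have a2 := H.hasDerivAt_re 2 (by norm_num) y
    have a3 := H.hasDerivAt_re 3 (by norm_num) y
    have b0 := H.hasDerivAt_im 0 (by norm_num) y
    have b1 := H.hasDerivAt_im 1 (by norm_num) y
    have b2 := H.hasDerivAt_im 2 (by norm_num) y
    have b3 := H.hasDerivAt_im 3 (by norm_num) y
    have hGd : HasDerivAt G (G' y) y := hasDerivAt_profile A B (C + ε) y
    obtain ⟨p0, p1⟩ := hasDerivAt_div_twice (hGpos y hy).ne' a0 a1 hGd (hG'd y)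
    obtain ⟨q0, q1⟩ := hasDerivAt_div_twice (hGpos y hy).ne' b0 b1 hGd (hG'd y)
    change HasDerivAt p (p₁ y) y at p0
    change HasDerivAt p₁ (p₂ y) y at p1
    change HasDerivAt q (q₁ y) y at q0
    change HasDerivAt q₁ (q₂ y) y at q1
    have h := (((hasDerivAt_id y).mul ((p0.pow 2).add (q0.pow 2))).const_mul (6 * -A)).sub
      (((((((a3.mul p0).sub (a2.mul p1)).add ((b3.mul q0).sub (b2.mul q1))).add
        ((hG'd y).mul ((p1.pow 2).add (q1.pow 2)))).add
        (((p0.mul p1).add (q0.mul q1)).const_mul (6 * A))).sub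
        (((a1.mul p0).add (b1.mul q0)).const_mul (2 * ξ ^ 2))).add
        (((hG'd y).mul ((p0.pow 2).add (q0.pow 2))).const_mul (ξ ^ 2)) |>.add
        (((b1.mul a0).sub (a1.mul b0)).const_mul ξ))
    refine h.congr_deriv ?_
    obtain ⟨ea0, ea1, ea2⟩ := jet_a y hy
    obtain ⟨eb0, eb1, eb2⟩ := jet_b y hy
    have hGe : 3 * A * y ^ 2 + B * y + C = G y - ε := by simp only [hG]; ring
    simp only [H.eq_re, H.eq_im, Pi.add_apply, Pi.pow_apply, id, hGe, zero_add,
      Nat.reduceAdd]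
    rw [ea0, eb0, ea1, eb1, ea2, eb2]
    ring
  refine integral_le_of_le_add_deriv (h0.const_mul _) ((hr.const_mul _).add (h2.const_mul _))
    hW ?_ (fun y hy => ?_)
  · simp [hp, hp₁, hq, hq₁, H.re_left, H.re_right, H.im_left, H.im_right]
  have hGy := hGpos y hy
  have hGM := hGle y hy
  obtain ⟨ea0, -, -⟩ := jet_a y hy
  obtain ⟨eb0, -, -⟩ := jet_b y hy
  have bound : ∀ u : ℝ, -A / M ^ 2 * (G y * u) ^ 2 ≤ -A * u ^ 2 := by
    intro u
    rw [div_mul_eq_mul_div, div_le_iff₀ (by positivity)]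
    have : (G y) ^ 2 ≤ M ^ 2 := by gcongr
    nlinarith [mul_le_mul_of_nonneg_right this (by positivity : 0 ≤ -A * u ^ 2)]
  have young : ∀ u v : ℝ, u * v ≤ -A * v ^ 2 + 1 / (4 * -A) * u ^ 2 := by
    intro u v
    have e : 0 ≤ 1 / (4 * -A) * (u - 2 * -A * v) ^ 2 := by positivity
    have hA0 : A ≠ 0 := hA.ne
    have e' : 1 / (4 * -A) * (u - 2 * -A * v) ^ 2
        = -A * v ^ 2 + 1 / (4 * -A) * u ^ 2 - u * v := by
      field_simp
      ring
    linarith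
  have hy2 : y ^ 2 ≤ 1 := by nlinarith [hy.1, hy.2]
  have poincare : ∀ u v : ℝ, 0 ≤ -A * (3 * u ^ 2 + 12 * v ^ 2 + 12 * (y * (u * v))) := by
    intro u v
    refine mul_nonneg hα.le ?_
    nlinarith [sq_nonneg (u + 2 * y * v), mul_le_mul_of_nonneg_right hy2 (sq_nonneg v)]
  have e1 := bound (p y)
  have e2 := bound (q y)
  have e3 := young (r y) (p y)
  have e4 := young (s y) (q y)
  have e5 := young (ξ * ε * b 2 y) (p y)
  have e6 := young (-(ξ * ε * a 2 y)) (q y)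
  have e7 := poincare (p y) (p₁ y)
  have e8 := poincare (q y) (q₁ y)
  have e9 : 0 ≤ G y * (p₂ y ^ 2 + q₂ y ^ 2) := by positivity
  have e10 : 0 ≤ 2 * ξ ^ 2 * (G y * (p₁ y ^ 2 + q₁ y ^ 2) + 3 * -A * (p y ^ 2 + q y ^ 2)) := by
    positivity
  have e11 : 0 ≤ ξ ^ 4 * (G y * (p y ^ 2 + q y ^ 2)) := by positivity
  rw [ea0, eb0]
  have e12 : ξ ^ 2 * ε ^ 2 / (4 * -A) * (a 2 y ^ 2 + b 2 y ^ 2)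
      = 1 / (4 * -A) * (ξ * ε * b 2 y) ^ 2 + 1 / (4 * -A) * (-(ξ * ε * a 2 y)) ^ 2 := by ring
  rw [e12]
  linarith

/-- Frequency-independent `L²` bound for a strictly concave profile. -/
theorem integral_normSq_le_of_concave (H : OrrSommerfeldJet A B C ξ a b r s) (hA : A < 0)
    (hB : |B| ≤ 3 * A + C) :
    ∫ y in (-1 : ℝ)..1, (a 0 y ^ 2 + b 0 y ^ 2)
      ≤ (|B| + |C| + 1) ^ 2 / (4 * A ^ 2) * ∫ y in (-1 : ℝ)..1, (r y ^ 2 + s y ^ 2) := by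
  set Φ := ∫ y in (-1 : ℝ)..1, (a 2 y ^ 2 + b 2 y ^ 2)
  set R := ∫ y in (-1 : ℝ)..1, (r y ^ 2 + s y ^ 2)
  have lim : Filter.Tendsto (fun ε : ℝ => 1 / (4 * -A) * R + ξ ^ 2 * ε ^ 2 / (4 * -A) * Φ)
      (nhdsWithin 0 (Set.Ioi 0)) (nhds (1 / (4 * -A) * R)) := by
    have : Continuous fun ε : ℝ => 1 / (4 * -A) * R + ξ ^ 2 * ε ^ 2 / (4 * -A) * Φ := by fun_prop
    have h := (this.tendsto 0).mono_left (nhdsWithin_le_nhds (s := Set.Ioi 0))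
    simpa using h
  have key := ge_of_tendsto lim (by
    filter_upwards [Ioc_mem_nhdsGT (zero_lt_one' ℝ)] with ε hε
    exact H.integral_normSq_le_add_of_concave hA hB hε.1 hε.2)
  have hM : 0 < (|B| + |C| + 1) ^ 2 := by positivity
  have hα : 0 < -A := by linarith
  rw [div_mul_eq_mul_div, div_le_iff₀ hM] at key
  have : A ≠ 0 := hA.ne
  have e : (|B| + |C| + 1) ^ 2 / (4 * A ^ 2) * R
      = 1 / (-A) * (1 / (4 * -A) * R * (|B| + |C| + 1) ^ 2) := by
    field_simp
  rw [e, div_mul_eq_mul_div, one_mul, le_div_iff₀ hα]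
  linarith

/-- `L²` bound under the sign conditions on the profile. -/
theorem exists_integral_normSq_le (hABC : (A, B, C) ≠ (0, 0, 0)) (hA : A ≤ 0)
    (hB : |B| ≤ 3 * A + C) :
    ∃ K ≥ 0, ∀ (ξ : ℝ), ξ ≠ 0 → ∀ (a b : ℕ → ℝ → ℝ) (r s : ℝ → ℝ),
      OrrSommerfeldJet A B C ξ a b r s →
      ξ ^ 2 * ∫ y in (-1 : ℝ)..1, (a 0 y ^ 2 + b 0 y ^ 2)
        ≤ K * (1 + ξ ^ 2) * ∫ y in (-1 : ℝ)..1, (r y ^ 2 + s y ^ 2) := by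
  have hnn : ∀ r s : ℝ → ℝ, 0 ≤ ∫ y in (-1 : ℝ)..1, (r y ^ 2 + s y ^ 2) := fun r s =>
    integral_nonneg (by norm_num) fun y _ => by positivity
  rcases hA.lt_or_eq with hA | rfl
  · refine ⟨(|B| + |C| + 1) ^ 2 / (4 * A ^ 2), by positivity, fun ξ _ a b r s H => ?_⟩
    have h := mul_le_mul_of_nonneg_left (H.integral_normSq_le_of_concave hA hB) (sq_nonneg ξ)
    have := mul_nonneg (by positivity : 0 ≤ (|B| + |C| + 1) ^ 2 / (4 * A ^ 2)) (hnn r s)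
    linarith
  · rw [mul_zero, zero_add] at hB
    have hC : 0 < C := by
      rcases ((abs_nonneg B).trans hB).lt_or_eq with h | rfl
      · exact h
      · exact absurd (by simp [abs_nonpos_iff.1 hB]) hABC
    refine ⟨256 / C ^ 2, by positivity, fun ξ hξ a b r s H => ?_⟩
    have h := mul_le_mul_of_nonneg_left (H.integral_normSq_le_of_linear hC hB hξ) (sq_nonneg ξ)
    have e : ∀ R : ℝ, ξ ^ 2 * (256 / (C ^ 2 * ξ ^ 2) * R) = 256 / C ^ 2 * R := fun R => by
      field_simp
    rw [e] at h
    have : 0 ≤ 256 / C ^ 2 * ξ ^ 2 * ∫ y in (-1 : ℝ)..1, (r y ^ 2 + s y ^ 2) :=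
      mul_nonneg (by positivity) (hnn r s)
    linarith

/-- The a priori estimate for real and imaginary parts. -/
theorem exists_integral_energy_le (hABC : (A, B, C) ≠ (0, 0, 0)) (hA : A ≤ 0)
    (hB : |B| ≤ 3 * A + C) :
    ∃ c > 0, ∀ (ξ : ℝ), ξ ≠ 0 → ∀ (a b : ℕ → ℝ → ℝ) (r s : ℝ → ℝ),
      OrrSommerfeldJet A B C ξ a b r s →
      ξ ^ 2 * ∫ y in (-1 : ℝ)..1, energy ξ a b y
        ≤ c * ∫ y in (-1 : ℝ)..1, (r y ^ 2 + s y ^ 2) := by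
  obtain ⟨K, hK, hbound⟩ := exists_integral_normSq_le hABC hA hB
  set M := 6 * |A| + |B| with hM
  have hM0 : 0 ≤ M := by positivity
  refine ⟨2 + ((M + 1) + (1 + 4 * (M + 1) * M ^ 2) * (K * (1 + (M + 1)))), by positivity,
    fun ξ hξ a b r s H => ?_⟩
  have hξ2 : 0 < ξ ^ 2 := by positivity
  have hR : 0 ≤ ∫ y in (-1 : ℝ)..1, (r y ^ 2 + s y ^ 2) :=
    integral_nonneg (by norm_num) fun y _ => by positivity
  have hφ : 0 ≤ ∫ y in (-1 : ℝ)..1, (a 0 y ^ 2 + b 0 y ^ 2) :=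
    integral_nonneg (by norm_num) fun y _ => by positivity
  have h0 := hbound ξ hξ a b r s H
  have h1 := H.integral_energy_le_add
  have h2 := H.integral_energy_le_of_large
  rw [← hM] at h1 h2
  set R := ∫ y in (-1 : ℝ)..1, (r y ^ 2 + s y ^ 2)
  set Φ := ∫ y in (-1 : ℝ)..1, (a 0 y ^ 2 + b 0 y ^ 2)
  rcases le_total (M + 1) (ξ ^ 2) with h | h
  · have e : ξ ^ 2 * (2 / ξ ^ 4 * R) ≤ 2 * R := by
      have : ξ ^ 2 * (2 / ξ ^ 4 * R) = 2 * R / ξ ^ 2 := by field_simp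
      rw [this, div_le_iff₀ hξ2]
      nlinarith
    have e' : 0 ≤ ((M + 1) + (1 + 4 * (M + 1) * M ^ 2) * (K * (1 + (M + 1)))) * R := by
      positivity
    linarith [mul_le_mul_of_nonneg_left (h2 h) hξ2.le]
  · calc ξ ^ 2 * ∫ y in (-1 : ℝ)..1, energy ξ a b y
        ≤ ξ ^ 2 * (R + (1 + 4 * ξ ^ 2 * M ^ 2) * Φ) := by gcongr
      _ = ξ ^ 2 * R + (1 + 4 * ξ ^ 2 * M ^ 2) * (ξ ^ 2 * Φ) := by ring
      _ ≤ (M + 1) * R + (1 + 4 * (M + 1) * M ^ 2) * (K * (1 + (M + 1)) * R) := by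
        have : ξ ^ 2 * Φ ≤ K * (1 + (M + 1)) * R := h0.trans (by gcongr)
        gcongr
      _ ≤ _ := by linarith

/-- A `C⁴` solution of the complex problem gives a jet of real and imaginary parts. -/
theorem of_contDiff {φ : ℝ → ℂ} (hφ : ContDiff ℝ 4 φ) (hl : φ (-1) = 0) (hr : φ 1 = 0)
    (hl' : deriv φ (-1) = 0) (hr' : deriv φ 1 = 0) {g : ℝ → ℂ}
    (hg : ∀ y, iteratedDeriv 4 φ y - 2 * (ξ : ℂ) ^ 2 * iteratedDeriv 2 φ y + (ξ : ℂ) ^ 4 * φ y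
      - Complex.I * (ξ : ℂ) *
        (((3 * A * y ^ 2 + B * y + C : ℝ) : ℂ) * (iteratedDeriv 2 φ y - (ξ : ℂ) ^ 2 * φ y)
          - 6 * (A : ℂ) * φ y) = g y) :
    OrrSommerfeldJet A B C ξ (fun k y => (iteratedDeriv k φ y).re)
      (fun k y => (iteratedDeriv k φ y).im) (fun y => (g y).re) (fun y => (g y).im) := by
  have hcont : ∀ k ≤ 4, Continuous (iteratedDeriv k φ) := fun k hk =>
    hφ.continuous_iteratedDeriv k (by exact_mod_cast hk)
  have hder : ∀ k < 4, ∀ y, HasDerivAt (iteratedDeriv k φ) (iteratedDeriv (k + 1) φ y) y := by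
    intro k hk y
    rw [iteratedDeriv_succ]
    exact (hφ.differentiable_iteratedDeriv k (by exact_mod_cast hk) y).hasDerivAt
  have hre : ∀ z : ℝ, ((z : ℂ) ^ 2) = ((z ^ 2 : ℝ) : ℂ) := fun z => by push_cast; rfl
  have hre4 : ∀ z : ℝ, ((z : ℂ) ^ 4) = ((z ^ 4 : ℝ) : ℂ) := fun z => by push_cast; rfl
  have hbd : ∀ y, φ y = 0 → deriv φ y = 0 → ∀ k < 2, iteratedDeriv k φ y = 0 := by
    intro y h h' k hk
    interval_cases k
    · simpa using h
    · simpa [iteratedDeriv_one] using h'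
  refine ⟨fun k hk => Complex.continuous_re.comp (hcont k hk),
    fun k hk => Complex.continuous_im.comp (hcont k hk),
    fun k hk y => Complex.reCLM.hasFDerivAt.comp_hasDerivAt y (hder k hk y),
    fun k hk y => Complex.imCLM.hasFDerivAt.comp_hasDerivAt y (hder k hk y),
    fun y => ?_, fun y => ?_,
    fun k hk => by simp [hbd _ hl hl' k hk], fun k hk => by simp [hbd _ hr hr' k hk],
    fun k hk => by simp [hbd _ hl hl' k hk], fun k hk => by simp [hbd _ hr hr' k hk]⟩
  · rw [← hg, hre, hre4]
    generalize 3 * A * y ^ 2 + B * y + C = F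
    simp only [iteratedDeriv_zero, Complex.add_re, Complex.sub_re, Complex.mul_re, Complex.mul_im,
      Complex.sub_im, Complex.ofReal_re, Complex.ofReal_im, Complex.I_re, Complex.I_im,
      Complex.re_ofNat, Complex.im_ofNat]
    ring
  · rw [← hg, hre, hre4]
    generalize 3 * A * y ^ 2 + B * y + C = F
    simp only [iteratedDeriv_zero, Complex.add_im, Complex.sub_re, Complex.mul_re, Complex.mul_im,
      Complex.sub_im, Complex.ofReal_re, Complex.ofReal_im, Complex.I_re, Complex.I_im,
      Complex.re_ofNat, Complex.im_ofNat]
    ring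

end OrrSommerfeldJet

/-- A priori estimate \eqref{key-apriori-0} for the non-homogeneous Orr–Sommerfeld problem:
under condition (ABC), there is `c > 0` depending only on `A, B, C` such that for every
`ξ ≠ 0`, every continuous datum `h` and every `C⁴` solution `φ`,
`∫(|φ''|² + 2ξ²|φ'|² + ξ⁴|φ|²) ≤ c·ξ⁻²·∫|h|²`. -/
theorem stmt_8 (A B C : ℝ) (hABC : (A, B, C) ≠ (0, 0, 0)) (hA : A ≤ 0)
    (hB : |B| ≤ 3 * A + C) :
    ∃ c > 0, ∀ (ξ : ℝ), ξ ≠ 0 → ∀ (h φ : ℝ → ℂ),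
      ContinuousOn h (Set.Icc (-1 : ℝ) 1) → ContDiff ℝ 4 φ →
      (∀ y ∈ Set.Ioo (-1 : ℝ) 1,
        iteratedDeriv 4 φ y - 2 * (ξ : ℂ) ^ 2 * iteratedDeriv 2 φ y + (ξ : ℂ) ^ 4 * φ y
          - Complex.I * (ξ : ℂ) *
              (((3 * A * y ^ 2 + B * y + C : ℝ) : ℂ) * (iteratedDeriv 2 φ y - (ξ : ℂ) ^ 2 * φ y)
                - 6 * (A : ℂ) * φ y) = h y) →
      φ (-1) = 0 → φ 1 = 0 → deriv φ (-1) = 0 → deriv φ 1 = 0 →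
      (∫ y in (-1 : ℝ)..1,
          (‖iteratedDeriv 2 φ y‖ ^ 2 + 2 * ξ ^ 2 * ‖deriv φ y‖ ^ 2 + ξ ^ 4 * ‖φ y‖ ^ 2))
        ≤ c * ξ⁻¹ ^ 2 * ∫ y in (-1 : ℝ)..1, ‖h y‖ ^ 2 := by
  obtain ⟨c, hc, hbound⟩ := OrrSommerfeldJet.exists_integral_energy_le hABC hA hB
  refine ⟨c, hc, fun ξ hξ h φ _ hφ heq hl hr hl' hr' => ?_⟩
  have key := hbound ξ hξ _ _ _ _
    (OrrSommerfeldJet.of_contDiff (A := A) (B := B) (C := C) (ξ := ξ) hφ hl hr hl' hr'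
      fun y => rfl)
  replace key := key.trans_eq (congrArg (c * ·)
    (integral_congr_Ioo_of_le (g := fun y => ‖h y‖ ^ 2) (by norm_num) fun y hy => by
      simp only [heq y hy, Complex.sq_norm, Complex.normSq_apply, ← sq]))
  have henergy : ∀ y, ‖iteratedDeriv 2 φ y‖ ^ 2 + 2 * ξ ^ 2 * ‖deriv φ y‖ ^ 2
      + ξ ^ 4 * ‖φ y‖ ^ 2 = OrrSommerfeldJet.energy ξ (fun k y => (iteratedDeriv k φ y).re)
        (fun k y => (iteratedDeriv k φ y).im) y := fun y => by
    simp only [OrrSommerfeldJet.energy, Complex.sq_norm, Complex.normSq_apply, iteratedDeriv_zero,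
      iteratedDeriv_one]
    ring
  simp only [henergy]
  have hξ2 : 0 < ξ ^ 2 := by positivity
  rw [inv_pow, mul_assoc, mul_left_comm, ← div_eq_inv_mul, le_div_iff₀ hξ2, mul_comm]
  exact key
end

section
/- Let A, B, C satisfy condition (ABC) and F(y) = 3Ay² + By + C, and let ξ ≠ 0. If φ : [-1,1] → ℂ is a C⁴ function satisfying the homogeneous Orr–Sommerfeld equation φ'''' − 2ξ²φ'' + ξ⁴φ − iξ[F(y)(φ'' − ξ²φ) − 6Aφ] = 0 on (-1,1) together with the boundary conditions φ(±1) = φ'(±1) = 0, then φ is identically zero. -/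
open Set Filter Topology

/-- Second-order vanishing: `f / (y - e)²` tends to half of the second derivative at `e`. -/
lemma tendsto_div_sq_of_hasDerivAt {f f' : ℝ → ℝ} {e a : ℝ} (hf : ∀ y, HasDerivAt f (f' y) y)
    (hf' : HasDerivAt f' a e) (h0 : f e = 0) (h1 : f' e = 0) :
    Tendsto (fun y => f y / (y - e) ^ 2) (𝓝[≠] e) (𝓝 (a / 2)) := by
  have hslope : Tendsto (fun y => f' y / (y - e)) (𝓝[≠] e) (𝓝 a) := by
    refine hf'.tendsto_slope.congr fun y => ?_
    rw [slope_def_field, h1, sub_zero]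
  have hne : ∀ᶠ y in 𝓝[≠] e, y ≠ e := eventually_mem_nhdsWithin
  refine HasDerivAt.lhopital_zero_nhdsNE (f' := f') (g' := fun y => 2 * (y - e))
    (Eventually.of_forall hf) (Eventually.of_forall fun y => ?_) ?_ ?_ ?_ ?_
  · exact (((hasDerivAt_id y).sub_const e).pow 2).congr_deriv (by simp)
  · filter_upwards [hne] with y hy
    exact mul_ne_zero two_ne_zero (sub_ne_zero.2 hy)
  · have := (hf e).continuousAt.tendsto
    rw [h0] at this
    exact this.mono_left nhdsWithin_le_nhds
  · have : ContinuousAt (fun y : ℝ => (y - e) ^ 2) e := by fun_prop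
    simpa [ContinuousAt] using this.tendsto.mono_left (nhdsWithin_le_nhds (s := {e}ᶜ))
  · refine (hslope.div_const 2).congr fun y => ?_
    rw [div_div, mul_comm]

/-- Boundary behaviour of `p = u / F` and of `p'` at a point `e` where `u` vanishes to second
order and `F` vanishes to order at most one. -/
lemma exists_tendsto_quotient {u u₁ F F₁ : ℝ → ℝ} {e a : ℝ}
    (hu : ∀ y, HasDerivAt u (u₁ y) y) (hu₁ : HasDerivAt u₁ a e)
    (hF : ∀ y, HasDerivAt F (F₁ y) y) (hF₁ : ContinuousAt F₁ e)
    (h0 : u e = 0) (h1 : u₁ e = 0) (hFe : F e = 0 → F₁ e ≠ 0) :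
    ∃ L, Tendsto (fun y => u y / F y) (𝓝[≠] e) (𝓝 0) ∧
      Tendsto (fun y => (u₁ y - F₁ y * (u y / F y)) / F y) (𝓝[≠] e) (𝓝 L) ∧
      a * L = 2 * F₁ e * L ^ 2 ∧ (F e = 0 ∨ L = 0) := by
  have hcu := (hu e).continuousAt.tendsto.mono_left (nhdsWithin_le_nhds (s := {e}ᶜ))
  have hcu₁ := hu₁.continuousAt.tendsto.mono_left (nhdsWithin_le_nhds (s := {e}ᶜ))
  have hcF := (hF e).continuousAt.tendsto.mono_left (nhdsWithin_le_nhds (s := {e}ᶜ))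
  have hcF₁ := hF₁.tendsto.mono_left (nhdsWithin_le_nhds (s := {e}ᶜ))
  by_cases hz : F e = 0
  · have hb := hFe hz
    have hne : ∀ᶠ y in 𝓝[≠] e, y ≠ e := eventually_mem_nhdsWithin
    have hlin : Tendsto (fun y => y - e) (𝓝[≠] e) (𝓝 0) := by
      have : ContinuousAt (fun y : ℝ => y - e) e := by fun_prop
      simpa [ContinuousAt] using this.tendsto.mono_left (nhdsWithin_le_nhds (s := {e}ᶜ))
    have hsu := tendsto_div_sq_of_hasDerivAt hu hu₁ h0 h1
    have hsu₁ : Tendsto (fun y => u₁ y / (y - e)) (𝓝[≠] e) (𝓝 a) := by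
      refine hu₁.tendsto_slope.congr fun y => ?_
      rw [slope_def_field, h1, sub_zero]
    have hsF : Tendsto (fun y => F y / (y - e)) (𝓝[≠] e) (𝓝 (F₁ e)) := by
      refine (hF e).tendsto_slope.congr fun y => ?_
      rw [slope_def_field, hz, sub_zero]
    have hq := hsu.div hsF hb
    refine ⟨(a - F₁ e * (a / 2 / F₁ e)) / F₁ e, ?_, ?_, ?_, Or.inl hz⟩
    · have := hlin.mul hq
      rw [zero_mul] at this
      refine this.congr' ?_
      filter_upwards [hne] with y hy
      have := sub_ne_zero.2 hy
      simp only [Pi.div_apply]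
      field_simp
    · refine ((hsu₁.sub (hcF₁.mul hq)).div hsF hb).congr' ?_
      filter_upwards [hne] with y hy
      have := sub_ne_zero.2 hy
      simp only [Pi.div_apply]
      field_simp
    · field_simp
      ring
  · have hq := hcu.div hcF hz
    have hr := (hcu₁.sub (hcF₁.mul hq)).div hcF hz
    rw [h0, zero_div] at hq
    rw [h0, h1, zero_div, mul_zero, sub_zero, zero_div] at hr
    exact ⟨0, hq, hr, by simp, Or.inr rfl⟩

/-- A nonincreasing function on an open interval whose limit at the left end is nonpositive and
whose limit at the right end is nonnegative vanishes. -/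
lemma AntitoneOn.eq_zero_of_tendsto {H : ℝ → ℝ} {a b l r : ℝ} (hH : AntitoneOn H (Ioo a b))
    (hl : Tendsto H (𝓝[>] a) (𝓝 l)) (hr : Tendsto H (𝓝[<] b) (𝓝 r)) (hl0 : l ≤ 0) (hr0 : 0 ≤ r)
    {y : ℝ} (hy : y ∈ Ioo a b) : H y = 0 := by
  refine le_antisymm (le_trans (ge_of_tendsto hl ?_) hl0) (hr0.trans (le_of_tendsto hr ?_))
  · filter_upwards [Ioo_mem_nhdsGT hy.1] with x hx
    exact hH ⟨hx.1, hx.2.trans hy.2⟩ hy hx.2.le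
  · filter_upwards [Ioo_mem_nhdsLT hy.2] with x hx
    exact hH hy ⟨hy.1.trans hx.1, hx.2⟩ hx.1.le

/-- The first two derivatives of a quotient `p = u / F`, written so that
`u' = F' p + F p'` and `u'' = F'' p + 2 F' p' + F p''`. -/
lemma hasDerivAt_quotient {u u₁ F F₁ : ℝ → ℝ} {u₂ F₂ y : ℝ}
    (hu : HasDerivAt u (u₁ y) y) (hu₁ : HasDerivAt u₁ u₂ y)
    (hF : HasDerivAt F (F₁ y) y) (hF₁ : HasDerivAt F₁ F₂ y) (hFy : F y ≠ 0) :
    HasDerivAt (fun y => u y / F y) ((u₁ y - F₁ y * (u y / F y)) / F y) y ∧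
      HasDerivAt (fun y => (u₁ y - F₁ y * (u y / F y)) / F y)
        ((u₂ - F₂ * (u y / F y) - 2 * F₁ y * ((u₁ y - F₁ y * (u y / F y)) / F y)) / F y) y := by
  have hp : HasDerivAt (fun y => u y / F y) ((u₁ y - F₁ y * (u y / F y)) / F y) y := by
    refine (hu.div hF hFy).congr_deriv ?_
    field_simp
  refine ⟨hp, ?_⟩
  refine ((hu₁.sub (hF₁.mul hp)).div hF hFy).congr_deriv ?_
  simp only [Pi.sub_apply, Pi.mul_apply]
  field_simp
  ring

/-- The energy flux whose monotonicity forces uniqueness; `p + i q` stands for `φ / F`. -/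
noncomputable def energyFlux (A ξ F F₁ u₁ u₂ u₃ v₁ v₂ v₃ p p₁ q q₁ : ℝ) : ℝ :=
  p * u₃ + q * v₃ - (p₁ * u₂ + q₁ * v₂) + 6 * A * (p * p₁ + q * q₁)
    + ξ * (F ^ 2 * (p * q₁ - q * p₁)) - 2 * ξ ^ 2 * (p * u₁ + q * v₁)
    + F₁ * (p₁ ^ 2 + q₁ ^ 2) + ξ ^ 2 * (F₁ * (p ^ 2 + q ^ 2))

/-- Along a solution of the real and imaginary parts of the Orr–Sommerfeld equation, the energy
flux has a sum of squares with nonpositive coefficients as its derivative. -/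
lemma hasDerivAt_energyFlux {A ξ : ℝ} {F F₁ u₁ u₂ u₃ v₁ v₂ v₃ p p₁ q q₁ : ℝ → ℝ}
    {y u v u₄ v₄ p₂ q₂ : ℝ}
    (hF : HasDerivAt F (F₁ y) y) (hF₁ : HasDerivAt F₁ (6 * A) y)
    (hu₁ : HasDerivAt u₁ (u₂ y) y) (hu₂ : HasDerivAt u₂ (u₃ y) y) (hu₃ : HasDerivAt u₃ u₄ y)
    (hv₁ : HasDerivAt v₁ (v₂ y) y) (hv₂ : HasDerivAt v₂ (v₃ y) y) (hv₃ : HasDerivAt v₃ v₄ y)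
    (dp : HasDerivAt p (p₁ y) y) (dp₁ : HasDerivAt p₁ p₂ y)
    (dq : HasDerivAt q (q₁ y) y) (dq₁ : HasDerivAt q₁ q₂ y)
    (eu : u = F y * p y) (ev : v = F y * q y)
    (eu₁ : u₁ y = F₁ y * p y + F y * p₁ y) (ev₁ : v₁ y = F₁ y * q y + F y * q₁ y)
    (eu₂ : u₂ y = 6 * A * p y + 2 * F₁ y * p₁ y + F y * p₂)
    (ev₂ : v₂ y = 6 * A * q y + 2 * F₁ y * q₁ y + F y * q₂)
    (hequ : u₄ - 2 * ξ ^ 2 * u₂ y + ξ ^ 4 * u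
      + ξ * (F y * (v₂ y - ξ ^ 2 * v) - 6 * A * v) = 0)
    (heqv : v₄ - 2 * ξ ^ 2 * v₂ y + ξ ^ 4 * v
      - ξ * (F y * (u₂ y - ξ ^ 2 * u) - 6 * A * u) = 0) :
    HasDerivAt (fun y => energyFlux A ξ (F y) (F₁ y) (u₁ y) (u₂ y) (u₃ y) (v₁ y) (v₂ y) (v₃ y)
        (p y) (p₁ y) (q y) (q₁ y))
      (-(F y * (p₂ ^ 2 + q₂ ^ 2) + (-12 * A) * (p₁ y ^ 2 + q₁ y ^ 2)
        + 2 * ξ ^ 2 * (F y * (p₁ y ^ 2 + q₁ y ^ 2)) + (-6 * A) * (ξ ^ 2 * (p y ^ 2 + q y ^ 2))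
        + ξ ^ 4 * (F y * (p y ^ 2 + q y ^ 2)))) y := by
  have d := (((((((dp.mul hu₃).add (dq.mul hv₃)).sub
    ((dp₁.mul hu₂).add (dq₁.mul hv₂))).add
    (((dp.mul dp₁).add (dq.mul dq₁)).const_mul (6 * A))).add
    (((hF.pow 2).mul ((dp.mul dq₁).sub (dq.mul dp₁))).const_mul ξ)).sub
    (((dp.mul hu₁).add (dq.mul hv₁)).const_mul (2 * ξ ^ 2))).add
    (hF₁.mul ((dp₁.pow 2).add (dq₁.pow 2)))).add
    ((hF₁.mul ((dp.pow 2).add (dq.pow 2))).const_mul (ξ ^ 2))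
  refine d.congr_deriv ?_
  simp only [Pi.add_apply, Pi.mul_apply, Pi.sub_apply, Pi.pow_apply]
  rw [eu₂, ev₂, eu, ev] at hequ heqv
  rw [eu₁, ev₁, eu₂, ev₂]
  push_cast
  linear_combination p y * hequ + q y * heqv

/-- The limit of the energy flux at a point where `p` and `q` tend to zero. -/
lemma tendsto_energyFlux {A ξ : ℝ} {F F₁ u₁ u₂ u₃ v₁ v₂ v₃ p p₁ q q₁ : ℝ → ℝ} {e L M : ℝ}
    (hF : ContinuousAt F e) (hF₁ : ContinuousAt F₁ e) (hu₁ : ContinuousAt u₁ e)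
    (hu₂ : ContinuousAt u₂ e) (hu₃ : ContinuousAt u₃ e) (hv₁ : ContinuousAt v₁ e)
    (hv₂ : ContinuousAt v₂ e) (hv₃ : ContinuousAt v₃ e)
    (tp : Tendsto p (𝓝[≠] e) (𝓝 0)) (tp₁ : Tendsto p₁ (𝓝[≠] e) (𝓝 L))
    (tq : Tendsto q (𝓝[≠] e) (𝓝 0)) (tq₁ : Tendsto q₁ (𝓝[≠] e) (𝓝 M))
    (hL : u₂ e * L = 2 * F₁ e * L ^ 2) (hM : v₂ e * M = 2 * F₁ e * M ^ 2) :
    Tendsto (fun y => energyFlux A ξ (F y) (F₁ y) (u₁ y) (u₂ y) (u₃ y) (v₁ y) (v₂ y) (v₃ y)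
      (p y) (p₁ y) (q y) (q₁ y)) (𝓝[≠] e) (𝓝 (-(F₁ e * (L ^ 2 + M ^ 2)))) := by
  have c : ∀ {f : ℝ → ℝ}, ContinuousAt f e → Tendsto f (𝓝[≠] e) (𝓝 (f e)) :=
    fun h => h.tendsto.mono_left nhdsWithin_le_nhds
  have hval : -(F₁ e * (L ^ 2 + M ^ 2)) = energyFlux A ξ (F e) (F₁ e) (u₁ e) (u₂ e) (u₃ e)
      (v₁ e) (v₂ e) (v₃ e) 0 L 0 M := by
    unfold energyFlux
    linear_combination hL + hM
  rw [hval]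
  exact (((((((tp.mul (c hu₃)).add (tq.mul (c hv₃))).sub
    ((tp₁.mul (c hu₂)).add (tq₁.mul (c hv₂)))).add
    (((tp.mul tp₁).add (tq.mul tq₁)).const_mul (6 * A))).add
    ((((c hF).pow 2).mul ((tp.mul tq₁).sub (tq.mul tp₁))).const_mul ξ)).sub
    (((tp.mul (c hu₁)).add (tq.mul (c hv₁))).const_mul (2 * ξ ^ 2))).add
    ((c hF₁).mul ((tp₁.pow 2).add (tq₁.pow 2)))).add
    (((c hF₁).mul ((tp.pow 2).add (tq.pow 2))).const_mul (ξ ^ 2))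

/-- Real form of the uniqueness theorem, for `φ = u + i v`. -/
theorem orrSommerfeld_real_unique {A B C ξ : ℝ} (hABC : (A, B, C) ≠ (0, 0, 0)) (hA : A ≤ 0)
    (hB : |B| ≤ 3 * A + C) (hξ : ξ ≠ 0) {u u₁ u₂ u₃ u₄ v v₁ v₂ v₃ v₄ : ℝ → ℝ}
    (hu : ∀ y, HasDerivAt u (u₁ y) y) (hu₁ : ∀ y, HasDerivAt u₁ (u₂ y) y)
    (hu₂ : ∀ y, HasDerivAt u₂ (u₃ y) y) (hu₃ : ∀ y, HasDerivAt u₃ (u₄ y) y)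
    (hv : ∀ y, HasDerivAt v (v₁ y) y) (hv₁ : ∀ y, HasDerivAt v₁ (v₂ y) y)
    (hv₂ : ∀ y, HasDerivAt v₂ (v₃ y) y) (hv₃ : ∀ y, HasDerivAt v₃ (v₄ y) y)
    (hequ : ∀ y ∈ Ioo (-1 : ℝ) 1, u₄ y - 2 * ξ ^ 2 * u₂ y + ξ ^ 4 * u y
      + ξ * ((3 * A * y ^ 2 + B * y + C) * (v₂ y - ξ ^ 2 * v y) - 6 * A * v y) = 0)
    (heqv : ∀ y ∈ Ioo (-1 : ℝ) 1, v₄ y - 2 * ξ ^ 2 * v₂ y + ξ ^ 4 * v y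
      - ξ * ((3 * A * y ^ 2 + B * y + C) * (u₂ y - ξ ^ 2 * u y) - 6 * A * u y) = 0)
    (hul : u (-1) = 0) (hur : u 1 = 0) (hul₁ : u₁ (-1) = 0) (hur₁ : u₁ 1 = 0)
    (hvl : v (-1) = 0) (hvr : v 1 = 0) (hvl₁ : v₁ (-1) = 0) (hvr₁ : v₁ 1 = 0) :
    ∀ y ∈ Ioo (-1 : ℝ) 1, u y = 0 ∧ v y = 0 := by
  obtain ⟨hB₁, hB₂⟩ := abs_le.1 hB
  have hAC : A = 0 → 0 < C := by
    intro h
    subst h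
    refine lt_of_le_of_ne (by linarith [abs_nonneg B]) fun hC => hABC ?_
    subst hC
    have : B = 0 := by linarith
    rw [this]
  set F : ℝ → ℝ := fun y => 3 * A * y ^ 2 + B * y + C with hFdef
  set F₁ : ℝ → ℝ := fun y => 6 * A * y + B with hF₁def
  have hF : ∀ y, HasDerivAt F (F₁ y) y := fun y => by
    have h := (((hasDerivAt_id y).pow 2).const_mul (3 * A)).add ((hasDerivAt_id y).const_mul B)
    refine (h.add_const C).congr_deriv ?_
    simp [hF₁def]
    ring
  have hF₁ : ∀ y, HasDerivAt F₁ (6 * A) y := fun y => by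
    exact (((hasDerivAt_id y).const_mul (6 * A)).add_const B).congr_deriv (mul_one _)
  have hFpos : ∀ y ∈ Ioo (-1 : ℝ) 1, 0 < F y := by
    rintro y ⟨hy₁, hy₂⟩
    simp only [hFdef]
    have h₁ : 0 < (1 - y) * (1 + y) := mul_pos (by linarith) (by linarith)
    have h₂ : 0 ≤ (1 - y) * (3 * A + C - B) := mul_nonneg (by linarith) (by linarith)
    have h₃ : 0 ≤ (1 + y) * (3 * A + C + B) := mul_nonneg (by linarith) (by linarith)
    rcases hA.lt_or_eq with h | h
    · nlinarith [mul_pos (neg_pos.2 h) h₁]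
    · have hC := hAC h
      subst h
      rcases lt_or_ge 0 y with h | h <;> nlinarith
  set p : ℝ → ℝ := fun y => u y / F y with hp
  set q : ℝ → ℝ := fun y => v y / F y with hq
  set p₁ : ℝ → ℝ := fun y => (u₁ y - F₁ y * p y) / F y with hp₁
  set q₁ : ℝ → ℝ := fun y => (v₁ y - F₁ y * q y) / F y with hq₁
  set p₂ : ℝ → ℝ := fun y => (u₂ y - 6 * A * p y - 2 * F₁ y * p₁ y) / F y with hp₂
  set q₂ : ℝ → ℝ := fun y => (v₂ y - 6 * A * q y - 2 * F₁ y * q₁ y) / F y with hq₂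
  set H : ℝ → ℝ := fun y => energyFlux A ξ (F y) (F₁ y) (u₁ y) (u₂ y) (u₃ y) (v₁ y) (v₂ y) (v₃ y)
    (p y) (p₁ y) (q y) (q₁ y)
  set E : ℝ → ℝ := fun y => F y * (p₂ y ^ 2 + q₂ y ^ 2) + (-12 * A) * (p₁ y ^ 2 + q₁ y ^ 2)
    + 2 * ξ ^ 2 * (F y * (p₁ y ^ 2 + q₁ y ^ 2)) + (-6 * A) * (ξ ^ 2 * (p y ^ 2 + q y ^ 2))
    + ξ ^ 4 * (F y * (p y ^ 2 + q y ^ 2)) with hEdef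
  have hderiv : ∀ y ∈ Ioo (-1 : ℝ) 1, HasDerivAt H (-E y) y := by
    intro y hy
    have hFy := (hFpos y hy).ne'
    obtain ⟨dp, dp₁⟩ := hasDerivAt_quotient (hu y) (hu₁ y) (hF y) (hF₁ y) hFy
    obtain ⟨dq, dq₁⟩ := hasDerivAt_quotient (hv y) (hv₁ y) (hF y) (hF₁ y) hFy
    change HasDerivAt p (p₁ y) y at dp
    change HasDerivAt q (q₁ y) y at dq
    change HasDerivAt p₁ (p₂ y) y at dp₁
    change HasDerivAt q₁ (q₂ y) y at dq₁
    exact hasDerivAt_energyFlux (hF y) (hF₁ y) (hu₁ y) (hu₂ y) (hu₃ y) (hv₁ y) (hv₂ y) (hv₃ y)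
      dp dp₁ dq dq₁ (mul_div_cancel₀ _ hFy).symm (mul_div_cancel₀ _ hFy).symm
      (by simp only [hp₁]; field_simp; ring) (by simp only [hq₁]; field_simp; ring)
      (by simp only [hp₂]; field_simp; ring) (by simp only [hq₂]; field_simp; ring)
      (hequ y hy) (heqv y hy)
  have hE : ∀ y ∈ Ioo (-1 : ℝ) 1, ξ ^ 4 * (F y * (p y ^ 2 + q y ^ 2)) ≤ E y := by
    intro y hy
    have hFy := (hFpos y hy).le
    have hA₁ : 0 ≤ -12 * A := by linarith
    have hA₂ : 0 ≤ -6 * A := by linarith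
    simp only [hEdef]
    refine le_add_of_nonneg_left ?_
    positivity
  have hanti : AntitoneOn H (Ioo (-1) 1) := by
    refine antitoneOn_of_deriv_nonpos (convex_Ioo _ _)
      (fun y hy => (hderiv y hy).continuousAt.continuousWithinAt) ?_ ?_ <;> rw [interior_Ioo]
    · exact fun y hy => (hderiv y hy).differentiableAt.differentiableWithinAt
    · intro y hy
      rw [(hderiv y hy).deriv, neg_nonpos]
      refine le_trans ?_ (hE y hy)
      have := (hFpos y hy).le
      positivity
  have hlim : ∀ e, u e = 0 → u₁ e = 0 → v e = 0 → v₁ e = 0 → (F e = 0 → F₁ e ≠ 0) →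
      ∃ N, 0 ≤ N ∧ (F e = 0 ∨ N = 0) ∧ Tendsto H (𝓝[≠] e) (𝓝 (-(F₁ e * N))) := by
    intro e h0 h1 k0 k1 hFe
    obtain ⟨L, tp, tp₁, aL, zL⟩ :=
      exists_tendsto_quotient hu (hu₁ e) hF (hF₁ e).continuousAt h0 h1 hFe
    obtain ⟨M, tq, tq₁, aM, zM⟩ :=
      exists_tendsto_quotient hv (hv₁ e) hF (hF₁ e).continuousAt k0 k1 hFe
    refine ⟨L ^ 2 + M ^ 2, by positivity, ?_, ?_⟩
    · rcases zL with h | h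
      · exact Or.inl h
      · rcases zM with h' | h'
        · exact Or.inl h'
        · exact Or.inr (by simp [h, h'])
    · exact tendsto_energyFlux (hF e).continuousAt (hF₁ e).continuousAt (hu₁ e).continuousAt
        (hu₂ e).continuousAt (hu₃ e).continuousAt (hv₁ e).continuousAt (hv₂ e).continuousAt
        (hv₃ e).continuousAt tp tp₁ tq tq₁ aL aM
  have hr : F 1 = 0 → F₁ 1 ≤ 0 ∧ F₁ 1 ≠ 0 := by
    simp only [hFdef, hF₁def]
    intro h
    refine ⟨by linarith, fun h' => ?_⟩
    have h0 : A = 0 := by linarith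
    linarith [hAC h0]
  have hl : F (-1) = 0 → 0 ≤ F₁ (-1) ∧ F₁ (-1) ≠ 0 := by
    simp only [hFdef, hF₁def]
    intro h
    refine ⟨by linarith, fun h' => ?_⟩
    have h0 : A = 0 := by linarith
    linarith [hAC h0]
  obtain ⟨N, hN, zN, tN⟩ := hlim (-1) hul hul₁ hvl hvl₁ fun h => (hl h).2
  obtain ⟨M, hM, zM, tM⟩ := hlim 1 hur hur₁ hvr hvr₁ fun h => (hr h).2
  have hl0 : -(F₁ (-1) * N) ≤ 0 := by
    rcases zN with h | h
    · linarith [mul_nonneg (hl h).1 hN]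
    · simp [h]
  have hr0 : 0 ≤ -(F₁ 1 * M) := by
    rcases zM with h | h
    · linarith [mul_nonpos_of_nonpos_of_nonneg (hr h).1 hM]
    · simp [h]
  have hH0 : ∀ y ∈ Ioo (-1 : ℝ) 1, H y = 0 := fun y hy =>
    hanti.eq_zero_of_tendsto (tN.mono_left (nhdsWithin_mono _ fun _ h => ne_of_gt h))
      (tM.mono_left (nhdsWithin_mono _ fun _ h => ne_of_lt h)) hl0 hr0 hy
  intro y hy
  have hEy : E y = 0 := by
    have h : HasDerivAt H 0 y := (hasDerivAt_const y (0 : ℝ)).congr_of_eventuallyEq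
      (eventually_of_mem (Ioo_mem_nhds hy.1 hy.2) hH0)
    linarith [(hderiv y hy).unique h]
  have hFy := hFpos y hy
  have hle := hE y hy
  rw [hEy] at hle
  have hξF : 0 < ξ ^ 4 * F y := by positivity
  have hpq : p y ^ 2 + q y ^ 2 ≤ 0 := by
    rw [← mul_assoc] at hle
    exact nonpos_of_mul_nonpos_right hle hξF
  have hpy : p y = 0 := by
    refine pow_eq_zero_iff two_ne_zero |>.1 (le_antisymm ?_ (sq_nonneg _))
    linarith [sq_nonneg (p y), sq_nonneg (q y)]
  have hqy : q y = 0 := by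
    refine pow_eq_zero_iff two_ne_zero |>.1 (le_antisymm ?_ (sq_nonneg _))
    linarith [sq_nonneg (p y), sq_nonneg (q y)]
  exact ⟨(div_eq_zero_iff.1 hpy).resolve_right hFy.ne',
    (div_eq_zero_iff.1 hqy).resolve_right hFy.ne'⟩

/-- Real and imaginary parts of the iterated derivatives of a `C⁴` function. -/
lemma hasDerivAt_re_im_iteratedDeriv {φ : ℝ → ℂ} (hφ : ContDiff ℝ 4 φ) {k : ℕ} (hk : k < 4)
    (y : ℝ) :
    HasDerivAt (fun y => (iteratedDeriv k φ y).re) (iteratedDeriv (k + 1) φ y).re y ∧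
      HasDerivAt (fun y => (iteratedDeriv k φ y).im) (iteratedDeriv (k + 1) φ y).im y := by
  have h : HasDerivAt (iteratedDeriv k φ) (iteratedDeriv (k + 1) φ y) y := by
    rw [iteratedDeriv_succ]
    exact (hφ.differentiable_iteratedDeriv k (by exact_mod_cast hk) y).hasDerivAt
  exact ⟨Complex.reCLM.hasFDerivAt.comp_hasDerivAt y h,
    Complex.imCLM.hasFDerivAt.comp_hasDerivAt y h⟩

/-- McLeod's uniqueness result: under condition (ABC), for `ξ ≠ 0` the homogeneous
Orr–Sommerfeld problem `φ'''' − 2ξ²φ'' + ξ⁴φ − iξ[F(φ'' − ξ²φ) − 6Aφ] = 0` on `(-1,1)`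
with `φ(±1) = φ'(±1) = 0` has only the trivial solution. -/
theorem stmt_9 (A B C : ℝ) (hABC : (A, B, C) ≠ (0, 0, 0)) (hA : A ≤ 0)
    (hB : |B| ≤ 3 * A + C) (ξ : ℝ) (hξ : ξ ≠ 0) (φ : ℝ → ℂ)
    (hφ : ContDiff ℝ 4 φ)
    (heq : ∀ y ∈ Set.Ioo (-1 : ℝ) 1,
      iteratedDeriv 4 φ y - 2 * (ξ : ℂ) ^ 2 * iteratedDeriv 2 φ y + (ξ : ℂ) ^ 4 * φ y
        - Complex.I * (ξ : ℂ) *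
            (((3 * A * y ^ 2 + B * y + C : ℝ) : ℂ) * (iteratedDeriv 2 φ y - (ξ : ℂ) ^ 2 * φ y)
              - 6 * (A : ℂ) * φ y) = 0)
    (hbc1 : φ (-1) = 0) (hbc2 : φ 1 = 0) (hbc3 : deriv φ (-1) = 0) (hbc4 : deriv φ 1 = 0) :
    ∀ y ∈ Set.Icc (-1 : ℝ) 1, φ y = 0 := by
  have hd := fun k hk y => hasDerivAt_re_im_iteratedDeriv hφ (k := k) hk y
  have key := orrSommerfeld_real_unique hABC hA hB hξ
    (fun y => (hd 0 (by norm_num) y).1) (fun y => (hd 1 (by norm_num) y).1)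
    (fun y => (hd 2 (by norm_num) y).1) (fun y => (hd 3 (by norm_num) y).1)
    (fun y => (hd 0 (by norm_num) y).2) (fun y => (hd 1 (by norm_num) y).2)
    (fun y => (hd 2 (by norm_num) y).2) (fun y => (hd 3 (by norm_num) y).2)
    (fun y hy => ?_) (fun y hy => ?_)
    (by simp [hbc1]) (by simp [hbc2]) (by simp [hbc3]) (by simp [hbc4])
    (by simp [hbc1]) (by simp [hbc2]) (by simp [hbc3]) (by simp [hbc4])
  · intro y hy
    rcases hy.1.eq_or_lt with h | h
    · rw [← h, hbc1]
    rcases hy.2.eq_or_lt with h' | h'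
    · rw [h', hbc2]
    obtain ⟨hre, him⟩ := key y ⟨h, h'⟩
    exact Complex.ext (by simpa using hre) (by simpa using him)
  · have h := congrArg Complex.re (heq y hy)
    simp [← Complex.ofReal_pow] at h
    simp
    linear_combination h
  · have h := congrArg Complex.im (heq y hy)
    simp [← Complex.ofReal_pow] at h
    simp
    linear_combination h
end

section
/- Let A, B, C satisfy condition (ABC) and F(y) = 3Ay² + By + C. For every ξ ≠ 0 and every continuous h : [-1,1] → ℂ, there exists exactly one C⁴ function φ : [-1,1] → ℂ satisfying φ'''' − 2ξ²φ'' + ξ⁴φ − iξ[F(y)(φ'' − ξ²φ) − 6Aφ] = h on (-1,1) and φ(±1) = φ'(±1) = 0; moreover this solution satisfies ∫₋₁¹(|φ''|² + 2ξ²|φ'|² + ξ⁴|φ|²)dy ≤ c·ξ⁻²·∫₋₁¹|h|²dy for a constant c > 0 depending only on A, B, C. -/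
open MeasureTheory intervalIntegral

open ComplexConjugate

/-- The Cauchy–Schwarz bound `(∫ f)² ≤ (b - a) ∫ f²` on an interval. -/
theorem sq_integral_le_mul_integral_sq {a b : ℝ} (hab : a ≤ b) {f : ℝ → ℝ}
    (hf : ContinuousOn f (Set.Icc a b)) :
    (∫ y in a..b, f y) ^ 2 ≤ (b - a) * ∫ y in a..b, f y ^ 2 := by
  rw [← Set.uIcc_of_le hab] at hf
  have hi : IntervalIntegrable f volume a b := hf.intervalIntegrable
  have hi2 : IntervalIntegrable (fun y => f y ^ 2) volume a b := (hf.pow 2).intervalIntegrable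
  have key : ∀ t : ℝ, 0 ≤ (b - a) * (t * t) + (-2 * ∫ y in a..b, f y) * t
      + ∫ y in a..b, f y ^ 2 := by
    intro t
    have h0 : 0 ≤ ∫ y in a..b, (f y - t) ^ 2 :=
      integral_nonneg hab fun y _ => sq_nonneg _
    have h1 : ∫ y in a..b, (f y - t) ^ 2
        = (∫ y in a..b, f y ^ 2) - (2 * t) * (∫ y in a..b, f y) + (b - a) * t ^ 2 := by
      have : ∀ y, (f y - t) ^ 2 = f y ^ 2 - (2 * t) * f y + t ^ 2 := fun y => by ring
      simp_rw [this]
      rw [integral_add (hi2.sub (hi.const_mul _)) intervalIntegrable_const,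
        integral_sub hi2 (hi.const_mul _), intervalIntegral.integral_const_mul,
        intervalIntegral.integral_const, smul_eq_mul]
    linarith [h0, h1]
  have := discrim_le_zero key
  rw [discrim] at this
  nlinarith

/-- A function vanishing at `±1` satisfies `|f(y)|² ≤ (1 - y²) ∫ |f'|²` on `[-1, 1]`. -/
theorem norm_sq_le_one_sub_sq_mul_integral {f f' : ℝ → ℂ}
    (hf : ∀ y ∈ Set.Icc (-1 : ℝ) 1, HasDerivAt f (f' y) y)
    (hf' : ContinuousOn f' (Set.Icc (-1) 1)) (hl : f (-1) = 0) (hr : f 1 = 0)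
    {y : ℝ} (hy : y ∈ Set.Icc (-1 : ℝ) 1) :
    ‖f y‖ ^ 2 ≤ (1 - y ^ 2) * ∫ t in (-1 : ℝ)..1, ‖f' t‖ ^ 2 := by
  obtain ⟨hy1, hy2⟩ := hy
  have hsub1 : Set.Icc (-1) y ⊆ Set.Icc (-1 : ℝ) 1 := Set.Icc_subset_Icc le_rfl hy2
  have hsub2 : Set.Icc y 1 ⊆ Set.Icc (-1 : ℝ) 1 := Set.Icc_subset_Icc hy1 le_rfl
  have bound : ∀ a b : ℝ, a ≤ b → Set.Icc a b ⊆ Set.Icc (-1 : ℝ) 1 →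
      ‖f b - f a‖ ^ 2 ≤ (b - a) * ∫ t in a..b, ‖f' t‖ ^ 2 := by
    intro a b hab hs
    rw [← integral_eq_sub_of_hasDerivAt (f := f) (f' := f')
      (fun t ht => hf t (hs (by rwa [Set.uIcc_of_le hab] at ht)))
      (ContinuousOn.intervalIntegrable (by rw [Set.uIcc_of_le hab]; exact hf'.mono hs))]
    calc ‖∫ t in a..b, f' t‖ ^ 2 ≤ (∫ t in a..b, ‖f' t‖) ^ 2 := by
          gcongr; exact norm_integral_le_integral_norm hab
      _ ≤ _ := sq_integral_le_mul_integral_sq hab (hf'.mono hs).norm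
  have b1 := bound (-1) y hy1 hsub1
  have b2 := bound y 1 hy2 hsub2
  have i1 : IntervalIntegrable (fun t => ‖f' t‖ ^ 2) volume (-1) y :=
    ContinuousOn.intervalIntegrable (by
      rw [Set.uIcc_of_le hy1]; exact (hf'.mono hsub1).norm.pow 2)
  have i2 : IntervalIntegrable (fun t => ‖f' t‖ ^ 2) volume y 1 :=
    ContinuousOn.intervalIntegrable (by
      rw [Set.uIcc_of_le hy2]; exact (hf'.mono hsub2).norm.pow 2)
  have hsum := integral_add_adjacent_intervals i1 i2
  have n1 : 0 ≤ ∫ t in (-1 : ℝ)..y, ‖f' t‖ ^ 2 := integral_nonneg hy1 fun _ _ => by positivity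
  have n2 : 0 ≤ ∫ t in y..(1 : ℝ), ‖f' t‖ ^ 2 := integral_nonneg hy2 fun _ _ => by positivity
  simp only [hl, hr, sub_zero, zero_sub, norm_neg] at b1 b2
  rw [← hsum]
  set p := ∫ t in (-1 : ℝ)..y, ‖f' t‖ ^ 2
  set q := ∫ t in y..(1 : ℝ), ‖f' t‖ ^ 2
  nlinarith [mul_nonneg (sub_nonneg.2 hy1) n1, mul_nonneg (sub_nonneg.2 hy2) n2,
    mul_le_mul_of_nonneg_left b1 (sub_nonneg.2 hy2),
    mul_le_mul_of_nonneg_left b2 (sub_nonneg.2 hy1)]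

/-- The functions `φ₁, …, φ₄` are the successive derivatives of `φ`, the last one is continuous,
and `φ` satisfies the clamped boundary conditions at `±1`. -/
structure IsClamped (φ φ₁ φ₂ φ₃ φ₄ : ℝ → ℂ) : Prop where
  deriv₀ : ∀ y, HasDerivAt φ (φ₁ y) y
  deriv₁ : ∀ y, HasDerivAt φ₁ (φ₂ y) y
  deriv₂ : ∀ y, HasDerivAt φ₂ (φ₃ y) y
  deriv₃ : ∀ y, HasDerivAt φ₃ (φ₄ y) y
  cont₄ : Continuous φ₄
  left₀ : φ (-1) = 0
  right₀ : φ 1 = 0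
  left₁ : φ₁ (-1) = 0
  right₁ : φ₁ 1 = 0

/-- The Orr–Sommerfeld expression in terms of the values of `φ`, `φ''` and `φ''''`. -/
noncomputable def orrSommerfeld (A B C ξ : ℝ) (φ φ₂ φ₄ : ℝ → ℂ) (y : ℝ) : ℂ :=
  φ₄ y - 2 * (ξ : ℂ) ^ 2 * φ₂ y + (ξ : ℂ) ^ 4 * φ y
    - Complex.I * (ξ : ℂ) * (((3 * A * y ^ 2 + B * y + C : ℝ) : ℂ) * (φ₂ y - (ξ : ℂ) ^ 2 * φ y)
      - 6 * (A : ℂ) * φ y)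

theorem hasDerivAt_conj {f : ℝ → ℂ} {f' : ℂ} {y : ℝ} (hf : HasDerivAt f f' y) :
    HasDerivAt (fun t => conj (f t)) (conj f') y := hf.star

theorem hasDerivAt_profile (A B C y : ℝ) :
    HasDerivAt (fun t : ℝ => ((3 * A * t ^ 2 + B * t + C : ℝ) : ℂ))
      ((6 * A * y + B : ℝ) : ℂ) y := by
  apply HasDerivAt.ofReal_comp
  have := (((hasDerivAt_id y).pow 2).const_mul (3 * A)).add ((hasDerivAt_id y).const_mul B)
  refine (this.add_const C).congr_deriv ?_
  simp
  ring

theorem hasDerivAt_profile_deriv (A B y : ℝ) :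
    HasDerivAt (fun t : ℝ => ((6 * A * t + B : ℝ) : ℂ)) (6 * (A : ℂ)) y := by
  have := (((hasDerivAt_id y).const_mul (6 * A)).add_const B).ofReal_comp
  refine this.congr_deriv ?_
  simp

namespace IsClamped

variable {φ φ₁ φ₂ φ₃ φ₄ : ℝ → ℂ}

theorem cont₀ (h : IsClamped φ φ₁ φ₂ φ₃ φ₄) : Continuous φ :=
  continuous_iff_continuousAt.2 fun y => (h.deriv₀ y).continuousAt

theorem cont₁ (h : IsClamped φ φ₁ φ₂ φ₃ φ₄) : Continuous φ₁ :=
  continuous_iff_continuousAt.2 fun y => (h.deriv₁ y).continuousAt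

theorem cont₂ (h : IsClamped φ φ₁ φ₂ φ₃ φ₄) : Continuous φ₂ :=
  continuous_iff_continuousAt.2 fun y => (h.deriv₂ y).continuousAt

theorem cont₃ (h : IsClamped φ φ₁ φ₂ φ₃ φ₄) : Continuous φ₃ :=
  continuous_iff_continuousAt.2 fun y => (h.deriv₃ y).continuousAt

theorem continuous_orrSommerfeld (h : IsClamped φ φ₁ φ₂ φ₃ φ₄) (A B C ξ : ℝ) :
    Continuous (orrSommerfeld A B C ξ φ φ₂ φ₄) := by
  have := h.cont₀
  have := h.cont₂
  have := h.cont₄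
  unfold orrSommerfeld
  fun_prop

/-- The energy inequality obtained by testing the equation with `φ`. -/
theorem integral_energy_le (h : IsClamped φ φ₁ φ₂ φ₃ φ₄) (A B C ξ : ℝ) :
    ∫ y in (-1 : ℝ)..1, (‖φ₂ y‖ ^ 2 + 2 * ξ ^ 2 * ‖φ₁ y‖ ^ 2 + ξ ^ 4 * ‖φ y‖ ^ 2)
      ≤ ∫ y in (-1 : ℝ)..1, (‖orrSommerfeld A B C ξ φ φ₂ φ₄ y‖ * ‖φ y‖
        + |ξ| * (6 * |A| + |B|) * (‖φ₁ y‖ * ‖φ y‖)) := by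
  have c0 := h.cont₀
  have c1 := h.cont₁
  have c2 := h.cont₂
  have c3 := h.cont₃
  have c4 := h.cont₄
  have cH := h.continuous_orrSommerfeld A B C ξ
  let W : ℝ → ℂ := fun y => φ₃ y * conj (φ y) - φ₂ y * conj (φ₁ y)
    - 2 * (ξ : ℂ) ^ 2 * (φ₁ y * conj (φ y))
    - Complex.I * ξ * (((3 * A * y ^ 2 + B * y + C : ℝ) : ℂ) * (φ₁ y * conj (φ y)))
  let W' : ℝ → ℂ := fun y => orrSommerfeld A B C ξ φ φ₂ φ₄ y * conj (φ y)
    - (φ₂ y * conj (φ₂ y) + 2 * (ξ : ℂ) ^ 2 * (φ₁ y * conj (φ₁ y))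
      + (ξ : ℂ) ^ 4 * (φ y * conj (φ y)))
    - Complex.I * ξ * (((3 * A * y ^ 2 + B * y + C : ℝ) : ℂ) * (φ₁ y * conj (φ₁ y))
      + ((6 * A * y + B : ℝ) : ℂ) * (φ₁ y * conj (φ y))
      + (ξ : ℂ) ^ 2 * ((3 * A * y ^ 2 + B * y + C : ℝ) : ℂ) * (φ y * conj (φ y))
      + 6 * (A : ℂ) * (φ y * conj (φ y)))
  have hW : ∀ y, HasDerivAt W (W' y) y := by
    intro y
    have k0 := hasDerivAt_conj (h.deriv₀ y)
    have k1 := hasDerivAt_conj (h.deriv₁ y)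
    have := ((((h.deriv₃ y).mul k0).sub ((h.deriv₂ y).mul k1)).sub
      (((h.deriv₁ y).mul k0).const_mul (2 * (ξ : ℂ) ^ 2))).sub
      (((hasDerivAt_profile A B C y).mul ((h.deriv₁ y).mul k0)).const_mul (Complex.I * ξ))
    refine this.congr_deriv ?_
    simp only [W', orrSommerfeld, Pi.mul_apply]
    ring
  have cW' : Continuous W' := by simp only [W']; fun_prop
  have hW_re : ∫ y in (-1 : ℝ)..1, (W' y).re = 0 := by
    have hd : ∀ y ∈ Set.uIcc (-1 : ℝ) 1, HasDerivAt (fun t => (W t).re) (W' y).re y :=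
      fun y _ => (Complex.reCLM.hasFDerivAt.comp_hasDerivAt y (hW y))
    rw [integral_eq_sub_of_hasDerivAt hd
      (Complex.continuous_re.comp cW').continuousOn.intervalIntegrable]
    simp [W, h.left₀, h.left₁, h.right₀, h.right₁]
  rw [← sub_nonneg, ← intervalIntegral.integral_sub
    (by apply Continuous.intervalIntegrable; fun_prop)
    (by apply Continuous.intervalIntegrable; fun_prop), ← hW_re]
  refine integral_mono_on (by norm_num)
    (Complex.continuous_re.comp cW').continuousOn.intervalIntegrable
    (by apply Continuous.intervalIntegrable; fun_prop) ?_
  intro y hy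
  have e1 : (W' y).re = (orrSommerfeld A B C ξ φ φ₂ φ₄ y * conj (φ y)).re
      - (‖φ₂ y‖ ^ 2 + 2 * ξ ^ 2 * ‖φ₁ y‖ ^ 2 + ξ ^ 4 * ‖φ y‖ ^ 2)
      + ξ * (6 * A * y + B) * (φ₁ y * conj (φ y)).im := by
    have : W' y = orrSommerfeld A B C ξ φ φ₂ φ₄ y * conj (φ y)
        - ((‖φ₂ y‖ ^ 2 + 2 * ξ ^ 2 * ‖φ₁ y‖ ^ 2 + ξ ^ 4 * ‖φ y‖ ^ 2 : ℝ) : ℂ)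
        - Complex.I * ((ξ * ((3 * A * y ^ 2 + B * y + C) * (‖φ₁ y‖ ^ 2 + ξ ^ 2 * ‖φ y‖ ^ 2)
          + 6 * A * ‖φ y‖ ^ 2) : ℝ) : ℂ)
        - Complex.I * (((ξ * (6 * A * y + B) : ℝ) : ℂ) * (φ₁ y * conj (φ y))) := by
      simp only [W', Complex.mul_conj']
      push_cast
      ring
    rw [this]
    simp only [Complex.sub_re, Complex.I_mul_re, Complex.ofReal_re, Complex.ofReal_im,
      Complex.im_ofReal_mul]
    ring
  have e2 : (orrSommerfeld A B C ξ φ φ₂ φ₄ y * conj (φ y)).re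
      ≤ ‖orrSommerfeld A B C ξ φ φ₂ φ₄ y‖ * ‖φ y‖ := by
    refine (Complex.re_le_norm _).trans ?_
    rw [norm_mul, Complex.norm_conj]
  have e3 : ξ * (6 * A * y + B) * (φ₁ y * conj (φ y)).im
      ≤ |ξ| * (6 * |A| + |B|) * (‖φ₁ y‖ * ‖φ y‖) := by
    refine (le_abs_self _).trans ?_
    rw [abs_mul, abs_mul]
    have hy1 : |y| ≤ 1 := abs_le.2 hy
    have a1 : |6 * A * y + B| ≤ 6 * |A| + |B| := by
      refine (abs_add_le _ _).trans ?_
      rw [abs_mul, abs_mul, abs_of_pos (by norm_num : (0 : ℝ) < 6)]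
      nlinarith [abs_nonneg A]
    have a2 : |(φ₁ y * conj (φ y)).im| ≤ ‖φ₁ y‖ * ‖φ y‖ := by
      refine (Complex.abs_im_le_norm _).trans ?_
      rw [norm_mul, Complex.norm_conj]
    gcongr
  linarith

/-- Testing the equation with `φ / F` yields an a priori bound for `φ` in `H¹`, when the profile
`F` is concave and positive on `[-1, 1]`. -/
theorem integral_norm_sq_le_of_pos (h : IsClamped φ φ₁ φ₂ φ₃ φ₄) {A B C ξ κ M K : ℝ} (hA : A ≤ 0)
    (hκ : 0 < κ) (hpos : ∀ y ∈ Set.Icc (-1 : ℝ) 1, 0 < 3 * A * y ^ 2 + B * y + C)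
    (hlow : ∀ y ∈ Set.Icc (-1 : ℝ) 1, κ * (1 - y ^ 2) ≤ 3 * A * y ^ 2 + B * y + C)
    (hM : ∀ y ∈ Set.Icc (-1 : ℝ) 1, 3 * A * y ^ 2 + B * y + C ≤ M)
    (hK : ∀ y ∈ Set.Icc (-1 : ℝ) 1, |6 * A * y + B| ≤ K) :
    ∫ y in (-1 : ℝ)..1, (‖φ y‖ ^ 2 + ‖φ₁ y‖ ^ 2)
      ≤ (4 * M ^ 2 + 4 * K ^ 2) * (8 / κ ^ 2)
        * ∫ y in (-1 : ℝ)..1, ‖orrSommerfeld A B C ξ φ φ₂ φ₄ y‖ ^ 2 := by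
  have c0 := h.cont₀
  have c1 := h.cont₁
  have c2 := h.cont₂
  have cH := h.continuous_orrSommerfeld A B C ξ
  set H := orrSommerfeld A B C ξ φ φ₂ φ₄ with hH
  have hI : Set.uIcc (-1 : ℝ) 1 = Set.Icc (-1) 1 := Set.uIcc_of_le (by norm_num)
  have integrable : ∀ {f : ℝ → ℝ}, ContinuousOn f (Set.Icc (-1) 1) →
      IntervalIntegrable f volume (-1) 1 := fun hf =>
    ContinuousOn.intervalIntegrable (by rwa [hI])
  let g : ℝ → ℂ := fun y => ((3 * A * y ^ 2 + B * y + C : ℝ) : ℂ)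
  let g₁ : ℝ → ℂ := fun y => ((6 * A * y + B : ℝ) : ℂ)
  have hg0 : ∀ y ∈ Set.Icc (-1 : ℝ) 1, g y ≠ 0 := fun y hy =>
    Complex.ofReal_ne_zero.2 (hpos y hy).ne'
  have dg : ∀ y, HasDerivAt g (g₁ y) y := hasDerivAt_profile A B C
  have dg₁ : ∀ y, HasDerivAt g₁ (6 * (A : ℂ)) y := hasDerivAt_profile_deriv A B
  have cg : Continuous g := by fun_prop
  have cg₁ : Continuous g₁ := by fun_prop
  let χ : ℝ → ℂ := fun y => φ y / g y
  let χ₁ : ℝ → ℂ := fun y => (φ₁ y - g₁ y * χ y) / g y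
  let χ₂ : ℝ → ℂ := fun y => (φ₂ y - 2 * g₁ y * χ₁ y - 6 * (A : ℂ) * χ y) / g y
  have e0 : ∀ y ∈ Set.Icc (-1 : ℝ) 1, φ y = g y * χ y := fun y hy => by
    simp only [χ]; field_simp [hg0 y hy]
  have e1 : ∀ y ∈ Set.Icc (-1 : ℝ) 1, φ₁ y = g₁ y * χ y + g y * χ₁ y := fun y hy => by
    simp only [χ₁]; field_simp [hg0 y hy]; ring
  have e2 : ∀ y ∈ Set.Icc (-1 : ℝ) 1,
      φ₂ y = g y * χ₂ y + 2 * g₁ y * χ₁ y + 6 * (A : ℂ) * χ y := fun y hy => by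
    simp only [χ₂]; field_simp [hg0 y hy]; ring
  have d0 : ∀ y ∈ Set.Icc (-1 : ℝ) 1, HasDerivAt χ (χ₁ y) y := fun y hy => by
    refine ((h.deriv₀ y).div (dg y) (hg0 y hy)).congr_deriv ?_
    have := hg0 y hy
    simp only [χ₁, χ]; field_simp
  have d1 : ∀ y ∈ Set.Icc (-1 : ℝ) 1, HasDerivAt χ₁ (χ₂ y) y := fun y hy => by
    refine (((h.deriv₁ y).sub ((dg₁ y).mul (d0 y hy))).div (dg y) (hg0 y hy)).congr_deriv ?_
    have := hg0 y hy
    simp only [χ₂, Pi.sub_apply, Pi.mul_apply, e1 y hy]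
    field_simp; ring
  have cχ : ContinuousOn χ (Set.Icc (-1) 1) := fun y hy =>
    (d0 y hy).continuousAt.continuousWithinAt
  have cχ₁ : ContinuousOn χ₁ (Set.Icc (-1) 1) := fun y hy =>
    (d1 y hy).continuousAt.continuousWithinAt
  have cχ₂ : ContinuousOn χ₂ (Set.Icc (-1) 1) := by
    refine ContinuousOn.div ?_ cg.continuousOn hg0
    fun_prop
  have l0 : χ (-1) = 0 := by simp [χ, h.left₀]
  have r0 : χ 1 = 0 := by simp [χ, h.right₀]
  have l1 : χ₁ (-1) = 0 := by simp [χ₁, h.left₁, l0]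
  have r1 : χ₁ 1 = 0 := by simp [χ₁, h.right₁, r0]
  set N := ∫ y in (-1 : ℝ)..1, ‖χ₁ y‖ ^ 2 with hN
  have hN0 : 0 ≤ N := integral_nonneg (by norm_num) fun _ _ => by positivity
  have hardy : ∀ y ∈ Set.Icc (-1 : ℝ) 1, ‖χ y‖ ^ 2 ≤ (1 - y ^ 2) * N := fun y hy =>
    norm_sq_le_one_sub_sq_mul_integral d0 cχ₁ l0 r0 hy
  have hχN : ∀ y ∈ Set.Icc (-1 : ℝ) 1, ‖χ y‖ ^ 2 ≤ N := fun y hy =>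
    (hardy y hy).trans (by nlinarith [sq_nonneg y])
  let q : ℝ → ℂ := fun y => χ₂ y - (ξ : ℂ) ^ 2 * χ y
  have cq : ContinuousOn q (Set.Icc (-1) 1) := by fun_prop
  set D := ∫ y in (-1 : ℝ)..1, (1 - y ^ 2) * ‖q y‖ ^ 2 with hD
  have ftc : ∀ {V V' : ℝ → ℂ} {a b : ℝ → ℝ},
      (∀ y ∈ Set.Icc (-1 : ℝ) 1, HasDerivAt V (V' y) y) →
      ContinuousOn V' (Set.Icc (-1) 1) → V (-1) = 0 → V 1 = 0 →
      ContinuousOn a (Set.Icc (-1) 1) → ContinuousOn b (Set.Icc (-1) 1) →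
      (∀ y ∈ Set.Icc (-1 : ℝ) 1, a y ≤ (V' y).re + b y) →
      ∫ y in (-1 : ℝ)..1, a y ≤ ∫ y in (-1 : ℝ)..1, b y := by
    intro V V' a b hV cV' hl hr ca cb hab
    have iV' : IntervalIntegrable (fun y => (V' y).re) volume (-1) 1 :=
      integrable (Complex.continuous_re.comp_continuousOn cV')
    have hd : ∀ y ∈ Set.uIcc (-1 : ℝ) 1, HasDerivAt (fun t => (V t).re) (V' y).re y :=
      fun y hy => Complex.reCLM.hasFDerivAt.comp_hasDerivAt y (hV y (by rwa [hI] at hy))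
    have hzero : ∫ y in (-1 : ℝ)..1, (V' y).re = 0 := by
      rw [integral_eq_sub_of_hasDerivAt hd iV']
      simp [hl, hr]
    have := integral_mono_on (by norm_num) (integrable ca) (iV'.add (integrable cb)) hab
    rwa [intervalIntegral.integral_add iV' (integrable cb), hzero, zero_add] at this
  -- the weighted norm of `q` controls `N`
  have hND : N ≤ 2 * D := by
    have cV : ContinuousOn (fun y => χ₂ y * conj (χ y) + χ₁ y * conj (χ₁ y)) (Set.Icc (-1) 1) := by
      fun_prop
    have hmono : N ≤ ∫ y in (-1 : ℝ)..1, ((1 - y ^ 2) * ‖q y‖ ^ 2 + N / 4) := by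
      refine ftc (V := fun y => χ₁ y * conj (χ y))
        (fun y hy => (d1 y hy).mul (hasDerivAt_conj (d0 y hy))) cV (by simp [l0]) (by simp [r0])
        (by fun_prop) (by fun_prop) ?_
      intro y hy
      have hz : χ₂ y * conj (χ y) + χ₁ y * conj (χ₁ y)
          = q y * conj (χ y) + ((ξ ^ 2 * ‖χ y‖ ^ 2 + ‖χ₁ y‖ ^ 2 : ℝ) : ℂ) := by
        push_cast
        rw [← Complex.mul_conj', ← Complex.mul_conj']
        simp only [q]; ring
      rw [hz, Complex.add_re, Complex.ofReal_re]
      have hre : -(‖q y‖ * ‖χ y‖) ≤ (q y * conj (χ y)).re := by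
        have := Complex.abs_re_le_norm (q y * conj (χ y))
        rw [norm_mul, Complex.norm_conj] at this
        exact (abs_le.1 this).1
      have hy2 : 0 ≤ 1 - y ^ 2 := by nlinarith [hy.1, hy.2]
      have hprod : ‖q y‖ * ‖χ y‖ ≤ (1 - y ^ 2) * ‖q y‖ ^ 2 + N / 4 := by
        refine abs_le_of_sq_le_sq' ?_ (by positivity) |>.2
        have := mul_le_mul_of_nonneg_left (hardy y hy) (sq_nonneg ‖q y‖)
        nlinarith [sq_nonneg ((1 - y ^ 2) * ‖q y‖ ^ 2 - N / 4)]
      nlinarith [mul_nonneg (sq_nonneg ξ) (sq_nonneg ‖χ y‖)]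
    rw [intervalIntegral.integral_add (integrable (by fun_prop)) (integrable (by fun_prop)),
      intervalIntegral.integral_const, smul_eq_mul] at hmono
    linarith
  -- testing with `χ`
  have hDH : κ * D ≤ 2 / κ * (∫ y in (-1 : ℝ)..1, ‖H y‖ ^ 2) + κ / 4 * N := by
    let V : ℝ → ℂ := fun y =>
      -((φ₃ y - (ξ : ℂ) ^ 2 * φ₁ y) * conj (χ y) - (φ₂ y - (ξ : ℂ) ^ 2 * φ y) * conj (χ₁ y)
        - Complex.I * ξ * ((g y * φ₁ y - g₁ y * φ y) * conj (χ y))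
        + 6 * (A : ℂ) * (χ y * conj (χ₁ y))
        + g₁ y * (χ₁ y * conj (χ₁ y)) - (ξ : ℂ) ^ 2 * (g₁ y * (χ y * conj (χ y))))
    let V' : ℝ → ℂ := fun y => g y * (q y * conj (q y)) - H y * conj (χ y)
        - 12 * (A : ℂ) * (χ₁ y * conj (χ₁ y))
        + Complex.I * ξ * (g y ^ 2 * (χ₁ y * conj (χ₁ y)
          + (ξ : ℂ) ^ 2 * (χ y * conj (χ y))))
        - g₁ y * (χ₂ y * conj (χ₁ y) - conj (χ₂ y * conj (χ₁ y)))
        - (ξ : ℂ) ^ 2 * (g₁ y * (χ₁ y * conj (χ y) - conj (χ₁ y * conj (χ y))))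
    have hV : ∀ y ∈ Set.Icc (-1 : ℝ) 1, HasDerivAt V (V' y) y := by
      intro y hy
      have k0 := hasDerivAt_conj (d0 y hy)
      have k1 := hasDerivAt_conj (d1 y hy)
      have := (((((((h.deriv₃ y).sub ((h.deriv₁ y).const_mul ((ξ : ℂ) ^ 2))).mul k0).sub
        (((h.deriv₂ y).sub ((h.deriv₀ y).const_mul ((ξ : ℂ) ^ 2))).mul k1)).sub
        (((((dg y).mul (h.deriv₁ y)).sub ((dg₁ y).mul (h.deriv₀ y))).mul k0).const_mul
          (Complex.I * ξ))).add (((d0 y hy).mul k1).const_mul (6 * (A : ℂ)))).add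
        ((dg₁ y).mul ((d1 y hy).mul k1))).sub
        (((dg₁ y).mul ((d0 y hy).mul k0)).const_mul ((ξ : ℂ) ^ 2))
      refine this.neg.congr_deriv ?_
      have hHy : H y = φ₄ y - 2 * (ξ : ℂ) ^ 2 * φ₂ y + (ξ : ℂ) ^ 4 * φ y
        - Complex.I * (ξ : ℂ) * (g y * (φ₂ y - (ξ : ℂ) ^ 2 * φ y) - 6 * (A : ℂ) * φ y) := rfl
      simp only [V', q, hHy, Pi.sub_apply, Pi.mul_apply, map_sub, map_mul, map_pow,
        Complex.conj_conj, Complex.conj_ofReal, e0 y hy, e1 y hy, e2 y hy]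
      ring
    have hmono : ∫ y in (-1 : ℝ)..1, κ * ((1 - y ^ 2) * ‖q y‖ ^ 2)
        ≤ ∫ y in (-1 : ℝ)..1, (2 / κ * ‖H y‖ ^ 2 + κ / 8 * N) := by
      refine ftc hV (by fun_prop) (by simp [V, l0, l1]) (by simp [V, r0, r1])
        (by fun_prop) (by fun_prop) ?_
      intro y hy
      have hre : (V' y).re = (3 * A * y ^ 2 + B * y + C) * ‖q y‖ ^ 2 - (H y * conj (χ y)).re
          - 12 * A * ‖χ₁ y‖ ^ 2 := by
        have : V' y = (((3 * A * y ^ 2 + B * y + C) * ‖q y‖ ^ 2 - 12 * A * ‖χ₁ y‖ ^ 2 : ℝ) : ℂ)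
            - H y * conj (χ y)
            + Complex.I * ((ξ * ((3 * A * y ^ 2 + B * y + C) ^ 2
              * (‖χ₁ y‖ ^ 2 + ξ ^ 2 * ‖χ y‖ ^ 2)) - (6 * A * y + B)
                * (2 * (χ₂ y * conj (χ₁ y)).im + ξ ^ 2 * (2 * (χ₁ y * conj (χ y)).im)) : ℝ) : ℂ)
            := by
          simp only [V', g, g₁, Complex.sub_conj, Complex.mul_conj']
          push_cast
          ring
        rw [this]
        simp only [Complex.add_re, Complex.sub_re, Complex.I_mul_re, Complex.ofReal_re,
          Complex.ofReal_im]
        ring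
      have hHχ : (H y * conj (χ y)).re ≤ ‖H y‖ * ‖χ y‖ := by
        refine (Complex.re_le_norm _).trans ?_
        rw [norm_mul, Complex.norm_conj]
      have hyoung : ‖H y‖ * ‖χ y‖ ≤ 2 / κ * ‖H y‖ ^ 2 + κ / 8 * ‖χ y‖ ^ 2 := by
        have : 2 / κ * ‖H y‖ ^ 2 + κ / 8 * ‖χ y‖ ^ 2 - ‖H y‖ * ‖χ y‖
            = 2 / κ * (‖H y‖ - κ / 4 * ‖χ y‖) ^ 2 := by
          field_simp
          ring
        have : 0 ≤ 2 / κ * (‖H y‖ - κ / 4 * ‖χ y‖) ^ 2 := by positivity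
        linarith
      have h1 := mul_le_mul_of_nonneg_right (hlow y hy) (sq_nonneg ‖q y‖)
      have h2 := mul_le_mul_of_nonneg_left (hχN y hy) (by positivity : 0 ≤ κ / 8)
      have h3 : 0 ≤ -A * ‖χ₁ y‖ ^ 2 := mul_nonneg (by linarith) (sq_nonneg _)
      rw [hre]
      linarith
    rw [intervalIntegral.integral_const_mul,
      intervalIntegral.integral_add (integrable (by fun_prop)) (integrable (by fun_prop)),
      intervalIntegral.integral_const, smul_eq_mul, intervalIntegral.integral_const_mul] at hmono
    linarith
  have hfin : ∫ y in (-1 : ℝ)..1, (‖φ y‖ ^ 2 + ‖φ₁ y‖ ^ 2) ≤ (4 * M ^ 2 + 4 * K ^ 2) * N := by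
    have hmono : ∫ y in (-1 : ℝ)..1, (‖φ y‖ ^ 2 + ‖φ₁ y‖ ^ 2)
        ≤ ∫ y in (-1 : ℝ)..1, ((M ^ 2 + 2 * K ^ 2) * N + 2 * M ^ 2 * ‖χ₁ y‖ ^ 2) := by
      refine integral_mono_on (by norm_num) (integrable (by fun_prop)) (integrable
        (by fun_prop)) ?_
      intro y hy
      have hg : ‖g y‖ ≤ M := by
        rw [Complex.norm_real, Real.norm_of_nonneg (hpos y hy).le]; exact hM y hy
      have hg₁ : ‖g₁ y‖ ≤ K := by rw [Complex.norm_real]; exact hK y hy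
      have b0 : ‖φ y‖ ≤ M * ‖χ y‖ := by
        rw [e0 y hy, norm_mul]; gcongr
      have b1 : ‖φ₁ y‖ ≤ K * ‖χ y‖ + M * ‖χ₁ y‖ := by
        rw [e1 y hy]
        refine (norm_add_le _ _).trans ?_
        rw [norm_mul, norm_mul]; gcongr
      have s0 : ‖φ y‖ ^ 2 ≤ (M * ‖χ y‖) ^ 2 := by gcongr
      have s1 : ‖φ₁ y‖ ^ 2 ≤ (K * ‖χ y‖ + M * ‖χ₁ y‖) ^ 2 := by gcongr
      have := mul_le_mul_of_nonneg_left (hχN y hy) (by positivity : 0 ≤ M ^ 2 + 2 * K ^ 2)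
      nlinarith [sq_nonneg (K * ‖χ y‖ - M * ‖χ₁ y‖)]
    refine hmono.trans_eq ?_
    rw [intervalIntegral.integral_add (integrable (by fun_prop)) (integrable (by fun_prop)),
      intervalIntegral.integral_const, smul_eq_mul, intervalIntegral.integral_const_mul]
    ring
  refine hfin.trans ?_
  rw [mul_assoc]
  gcongr
  set S := ∫ y in (-1 : ℝ)..1, ‖H y‖ ^ 2
  have : κ ^ 2 * N ≤ 8 * S := by
    have h1 : κ * N / 4 ≤ 2 / κ * S := by nlinarith
    calc κ ^ 2 * N = 4 * κ * (κ * N / 4) := by ring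
      _ ≤ 4 * κ * (2 / κ * S) := by gcongr
      _ = 8 * S := by field_simp; ring
  rw [div_mul_eq_mul_div, le_div_iff₀ (by positivity)]
  linarith

/-- The `H¹` a priori bound for nonnegative profiles, with a constant independent of `ξ`. -/
theorem exists_integral_norm_sq_le {A B C : ℝ} (hABC : (A, B, C) ≠ (0, 0, 0)) (hA : A ≤ 0)
    (hB : |B| ≤ 3 * A + C) :
    ∃ R ≥ 0, ∀ (ξ : ℝ) (φ φ₁ φ₂ φ₃ φ₄ : ℝ → ℂ), IsClamped φ φ₁ φ₂ φ₃ φ₄ →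
      ∫ y in (-1 : ℝ)..1, (‖φ y‖ ^ 2 + ‖φ₁ y‖ ^ 2)
        ≤ R * ∫ y in (-1 : ℝ)..1, ‖orrSommerfeld A B C ξ φ φ₂ φ₄ y‖ ^ 2 := by
  have hB0 := abs_nonneg B
  have hκ : 0 < (C - 3 * A) / 2 := by
    by_contra hcon
    have hA0 : A = 0 := by linarith
    have hC0 : C = 0 := by linarith
    have hB1 : B = 0 := abs_eq_zero.1 (by linarith)
    exact hABC (by simp [hA0, hB1, hC0])
  set κ := (C - 3 * A) / 2 with hκdef
  set R := (4 * (|B| + C + 1) ^ 2 + 4 * (6 * |A| + |B|) ^ 2) * (8 / κ ^ 2) with hR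
  have hR0 : 0 ≤ R := by positivity
  refine ⟨R * 2, by positivity, fun ξ φ φ₁ φ₂ φ₃ φ₄ h => ?_⟩
  have c0 := h.cont₀
  have c2 := h.cont₂
  have cH := h.continuous_orrSommerfeld A B C ξ
  set S := ∫ y in (-1 : ℝ)..1, ‖orrSommerfeld A B C ξ φ φ₂ φ₄ y‖ ^ 2
  set T := ∫ y in (-1 : ℝ)..1, ‖φ₂ y - (ξ : ℂ) ^ 2 * φ y‖ ^ 2
  have hT : 0 ≤ T := integral_nonneg (by norm_num) fun _ _ => by positivity
  have regularized : ∀ ε : ℝ, 0 < ε → ε ≤ 1 →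
      ∫ y in (-1 : ℝ)..1, (‖φ y‖ ^ 2 + ‖φ₁ y‖ ^ 2) ≤ R * (2 * S + 2 * (ξ * ε) ^ 2 * T) := by
    intro ε hε hε1
    have lower : ∀ y ∈ Set.Icc (-1 : ℝ) 1,
        κ * (1 - y ^ 2) + ε ≤ 3 * A * y ^ 2 + B * y + (C + ε) := by
      intro y hy
      have hy1 : |y| ≤ 1 := abs_le.2 hy
      have hBy : -(|B| * |y|) ≤ B * y := by rw [← abs_mul]; exact neg_abs_le _
      have : 0 ≤ (3 * A + C) * (1 - |y|) ^ 2 :=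
        mul_nonneg (hB0.trans hB) (sq_nonneg _)
      have := mul_le_mul_of_nonneg_right hB (abs_nonneg y)
      rw [hκdef]
      nlinarith [sq_abs y]
    have hy2 : ∀ y ∈ Set.Icc (-1 : ℝ) 1, 0 ≤ 1 - y ^ 2 := fun y hy => by nlinarith [hy.1, hy.2]
    have key := integral_norm_sq_le_of_pos h (A := A) (B := B) (C := C + ε) (ξ := ξ) (κ := κ)
      (M := |B| + C + 1) (K := 6 * |A| + |B|) hA hκ
      (fun y hy => by linarith [lower y hy, mul_nonneg hκ.le (hy2 y hy)])
      (fun y hy => by linarith [lower y hy])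
      (fun y hy => by
        have hBy : B * y ≤ |B| := by
          refine (le_abs_self _).trans ?_
          rw [abs_mul]
          exact mul_le_of_le_one_right hB0 (abs_le.2 hy)
        nlinarith [sq_nonneg y])
      (fun y hy => by
        refine (abs_add_le _ _).trans ?_
        rw [abs_mul, abs_mul, abs_of_pos (by norm_num : (0 : ℝ) < 6)]
        have : |y| ≤ 1 := abs_le.2 hy
        nlinarith [abs_nonneg A])
    refine key.trans ?_
    rw [← hR]
    gcongr
    have cHε := h.continuous_orrSommerfeld A B (C + ε) ξ
    rw [← intervalIntegral.integral_const_mul, ← intervalIntegral.integral_const_mul,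
      ← intervalIntegral.integral_add (by apply Continuous.intervalIntegrable; fun_prop)
      (by apply Continuous.intervalIntegrable; fun_prop)]
    refine integral_mono_on (by norm_num) (by apply Continuous.intervalIntegrable; fun_prop)
      (by apply Continuous.intervalIntegrable; fun_prop) fun y _ => ?_
    have hsplit : orrSommerfeld A B (C + ε) ξ φ φ₂ φ₄ y = orrSommerfeld A B C ξ φ φ₂ φ₄ y
        + -(Complex.I * ((ξ * ε : ℝ) : ℂ) * (φ₂ y - (ξ : ℂ) ^ 2 * φ y)) := by
      simp only [orrSommerfeld]
      push_cast
      ring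
    have hn := norm_add_le (orrSommerfeld A B C ξ φ φ₂ φ₄ y)
      (-(Complex.I * ((ξ * ε : ℝ) : ℂ) * (φ₂ y - (ξ : ℂ) ^ 2 * φ y)))
    rw [← hsplit, norm_neg, norm_mul, norm_mul, Complex.norm_I, one_mul, Complex.norm_real,
      Real.norm_eq_abs] at hn
    rw [← sq_abs (ξ * ε)]
    set u := ‖orrSommerfeld A B C ξ φ φ₂ φ₄ y‖
    set v := |ξ * ε|
    set w := ‖φ₂ y - (ξ : ℂ) ^ 2 * φ y‖
    calc ‖orrSommerfeld A B (C + ε) ξ φ φ₂ φ₄ y‖ ^ 2 ≤ (u + v * w) ^ 2 := by gcongr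
      _ ≤ 2 * u ^ 2 + 2 * v ^ 2 * w ^ 2 := by nlinarith [sq_nonneg (u - v * w)]
  refine le_of_forall_pos_le_add fun δ hδ => ?_
  set b := R * (2 * ξ ^ 2 * T) with hb
  have hb0 : 0 ≤ b := by positivity
  have hε : 0 < min 1 (δ / (b + 1)) := by positivity
  have hle := regularized _ hε (min_le_left _ _)
  set ε := min 1 (δ / (b + 1))
  have h1 : ε ≤ 1 := min_le_left _ _
  have h2 : ε * (b + 1) ≤ δ := (le_div_iff₀ (by positivity)).1 (min_le_right _ _)
  have h3 : ε ^ 2 * b ≤ ε * b := by gcongr; nlinarith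
  calc _ ≤ _ := hle
    _ = R * 2 * S + ε ^ 2 * b := by rw [hb]; ring
    _ ≤ R * 2 * S + δ := by nlinarith

/-- The a priori estimate for the clamped Orr–Sommerfeld problem. -/
theorem exists_integral_energy_le {A B C : ℝ} (hABC : (A, B, C) ≠ (0, 0, 0)) (hA : A ≤ 0)
    (hB : |B| ≤ 3 * A + C) :
    ∃ c > 0, ∀ ξ : ℝ, ξ ≠ 0 → ∀ φ φ₁ φ₂ φ₃ φ₄ : ℝ → ℂ, IsClamped φ φ₁ φ₂ φ₃ φ₄ →
      ∫ y in (-1 : ℝ)..1, (‖φ₂ y‖ ^ 2 + 2 * ξ ^ 2 * ‖φ₁ y‖ ^ 2 + ξ ^ 4 * ‖φ y‖ ^ 2)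
        ≤ c * ξ⁻¹ ^ 2 * ∫ y in (-1 : ℝ)..1, ‖orrSommerfeld A B C ξ φ φ₂ φ₄ y‖ ^ 2 := by
  obtain ⟨R, hR0, hR⟩ := exists_integral_norm_sq_le hABC hA hB
  set K := 6 * |A| + |B| with hK
  refine ⟨4 + K ^ 4 * R + (1 + K ^ 2) * R, by positivity, fun ξ hξ φ φ₁ φ₂ φ₃ φ₄ h => ?_⟩
  have c0 := h.cont₀
  have c1 := h.cont₁
  have c2 := h.cont₂
  have cH := h.continuous_orrSommerfeld A B C ξ
  have hQ := hR ξ φ φ₁ φ₂ φ₃ φ₄ h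
  have henergy := h.integral_energy_le A B C ξ
  rw [← hK] at henergy
  set H := orrSommerfeld A B C ξ φ φ₂ φ₄
  set S := ∫ y in (-1 : ℝ)..1, ‖H y‖ ^ 2
  set E := ∫ y in (-1 : ℝ)..1, (‖φ₂ y‖ ^ 2 + 2 * ξ ^ 2 * ‖φ₁ y‖ ^ 2 + ξ ^ 4 * ‖φ y‖ ^ 2) with hE
  have nonneg : ∀ f : ℝ → ℂ, 0 ≤ ∫ y in (-1 : ℝ)..1, ‖f y‖ ^ 2 := fun f =>
    integral_nonneg (by norm_num) fun _ _ => by positivity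
  have hS : 0 ≤ S := nonneg H
  have ha := nonneg φ
  have hb := nonneg φ₁
  have hd := nonneg φ₂
  have hEsum : E = (∫ y in (-1 : ℝ)..1, ‖φ₂ y‖ ^ 2) + 2 * ξ ^ 2 * (∫ y in (-1 : ℝ)..1, ‖φ₁ y‖ ^ 2)
      + ξ ^ 4 * ∫ y in (-1 : ℝ)..1, ‖φ y‖ ^ 2 := by
    rw [hE, intervalIntegral.integral_add (by apply Continuous.intervalIntegrable; fun_prop)
      (by apply Continuous.intervalIntegrable; fun_prop),
      intervalIntegral.integral_add (by apply Continuous.intervalIntegrable; fun_prop)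
      (by apply Continuous.intervalIntegrable; fun_prop), intervalIntegral.integral_const_mul,
      intervalIntegral.integral_const_mul]
  rw [intervalIntegral.integral_add (by apply Continuous.intervalIntegrable; fun_prop)
      (by apply Continuous.intervalIntegrable; fun_prop)] at hQ
  have young : ∀ s : ℝ, 0 < s → E ≤ s * S
      + (1 / (4 * s) + K ^ 2 / 2) * (∫ y in (-1 : ℝ)..1, ‖φ y‖ ^ 2)
      + ξ ^ 2 / 2 * ∫ y in (-1 : ℝ)..1, ‖φ₁ y‖ ^ 2 := by
    intro s hs
    refine henergy.trans ?_
    rw [← intervalIntegral.integral_const_mul, ← intervalIntegral.integral_const_mul,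
      ← intervalIntegral.integral_const_mul,
      ← intervalIntegral.integral_add (by apply Continuous.intervalIntegrable; fun_prop)
      (by apply Continuous.intervalIntegrable; fun_prop),
      ← intervalIntegral.integral_add (by apply Continuous.intervalIntegrable; fun_prop)
      (by apply Continuous.intervalIntegrable; fun_prop)]
    refine integral_mono_on (by norm_num) (by apply Continuous.intervalIntegrable; fun_prop)
      (by apply Continuous.intervalIntegrable; fun_prop) fun y _ => ?_
    have h1 : ‖H y‖ * ‖φ y‖ ≤ s * ‖H y‖ ^ 2 + 1 / (4 * s) * ‖φ y‖ ^ 2 := by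
      have e : s * ‖H y‖ ^ 2 + 1 / (4 * s) * ‖φ y‖ ^ 2 - ‖H y‖ * ‖φ y‖
          = s * (‖H y‖ - 1 / (2 * s) * ‖φ y‖) ^ 2 := by
        field_simp
        ring
      have : 0 ≤ s * (‖H y‖ - 1 / (2 * s) * ‖φ y‖) ^ 2 := by positivity
      linarith
    have h2 : |ξ| * K * (‖φ₁ y‖ * ‖φ y‖) ≤ ξ ^ 2 / 2 * ‖φ₁ y‖ ^ 2 + K ^ 2 / 2 * ‖φ y‖ ^ 2 := by
      rw [← sq_abs ξ]
      nlinarith [sq_nonneg (|ξ| * ‖φ₁ y‖ - K * ‖φ y‖)]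
    linarith
  clear_value S E
  set a := ∫ y in (-1 : ℝ)..1, ‖φ y‖ ^ 2
  set b := ∫ y in (-1 : ℝ)..1, ‖φ₁ y‖ ^ 2
  set d := ∫ y in (-1 : ℝ)..1, ‖φ₂ y‖ ^ 2
  have hξ2 : 0 < ξ ^ 2 := by positivity
  have haR : a ≤ R * S := by linarith
  have hRS : 0 ≤ R * S := by positivity
  have hE0 : 0 ≤ E := by rw [hEsum]; positivity
  have hK2 : 0 ≤ K ^ 2 * (R * S) := by positivity
  have hK4 : 0 ≤ K ^ 4 * (R * S) := by positivity
  suffices hmain : ξ ^ 2 * E ≤ (4 + K ^ 4 * R + (1 + K ^ 2) * R) * S by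
    calc E = ξ⁻¹ ^ 2 * (ξ ^ 2 * E) := by field_simp
      _ ≤ ξ⁻¹ ^ 2 * ((4 + K ^ 4 * R + (1 + K ^ 2) * R) * S) := by gcongr
      _ = _ := by ring
  rcases le_total (ξ ^ 2) 1 with h1 | h1
  · have hy := young 1 one_pos
    have h2 : ξ ^ 2 * E ≤ E := mul_le_of_le_one_left hE0 h1
    have h3 : ξ ^ 2 * b ≤ b := mul_le_of_le_one_left hb h1
    have h4 : K ^ 2 * a ≤ K ^ 2 * (R * S) := by gcongr
    nlinarith
  · have hy := mul_le_mul_of_nonneg_left (young (1 / ξ ^ 2) (by positivity)) hξ2.le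
    have hexp : ξ ^ 2 * (1 / ξ ^ 2 * S + (1 / (4 * (1 / ξ ^ 2)) + K ^ 2 / 2) * a + ξ ^ 2 / 2 * b)
        = S + ξ ^ 4 * a / 4 + ξ ^ 2 * K ^ 2 * a / 2 + ξ ^ 2 * (ξ ^ 2 * b) / 2 := by
      field_simp
      ring
    rw [hexp] at hy
    have h2 : E ≤ ξ ^ 2 * E := le_mul_of_one_le_left hE0 h1
    have h3 : ξ ^ 2 * K ^ 2 * a ≤ K ^ 4 * a / 2 + ξ ^ 4 * a / 2 := by
      nlinarith [mul_nonneg ha (sq_nonneg (ξ ^ 2 - K ^ 2))]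
    have h4 : K ^ 4 * a ≤ K ^ 4 * (R * S) := by gcongr
    have h5 : ξ ^ 4 * a ≤ E := by
      have : 0 ≤ ξ ^ 2 * b := by positivity
      linarith
    have h6 : ξ ^ 2 * (ξ ^ 2 * b) ≤ ξ ^ 2 * (E / 2) := by
      have : 0 ≤ ξ ^ 4 * a := by positivity
      gcongr
      linarith
    nlinarith

end IsClamped

namespace IsClamped

variable {φ φ₁ φ₂ φ₃ φ₄ : ℝ → ℂ}

/-- A clamped solution of the homogeneous problem vanishes on `[-1, 1]`. -/
theorem eqOn_zero (h : IsClamped φ φ₁ φ₂ φ₃ φ₄) {A B C ξ : ℝ} (hABC : (A, B, C) ≠ (0, 0, 0))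
    (hA : A ≤ 0) (hB : |B| ≤ 3 * A + C) (hξ : ξ ≠ 0)
    (hzero : ∀ y ∈ Set.Ioo (-1 : ℝ) 1, orrSommerfeld A B C ξ φ φ₂ φ₄ y = 0) :
    ∀ y ∈ Set.Icc (-1 : ℝ) 1, φ y = 0 := by
  obtain ⟨c, -, hc⟩ := exists_integral_energy_le hABC hA hB
  have hE := hc ξ hξ φ φ₁ φ₂ φ₃ φ₄ h
  have c0 := h.cont₀
  have c1 := h.cont₁
  have c2 := h.cont₂
  have hcl : Set.EqOn (orrSommerfeld A B C ξ φ φ₂ φ₄) (fun _ => 0) (closure (Set.Ioo (-1) 1)) :=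
    Set.EqOn.closure hzero (h.continuous_orrSommerfeld A B C ξ) continuous_const
  rw [closure_Ioo (by norm_num)] at hcl
  have hS : ∫ y in (-1 : ℝ)..1, ‖orrSommerfeld A B C ξ φ φ₂ φ₄ y‖ ^ 2 = 0 := by
    rw [integral_congr (g := fun _ => (0 : ℝ)) fun y hy => by
      rw [Set.uIcc_of_le (by norm_num)] at hy
      simp [hcl hy]]
    simp
  rw [hS, mul_zero] at hE
  intro y hy
  by_contra hne
  have hφ : 0 < ‖φ y‖ := norm_pos_iff.2 hne
  refine hE.not_gt (intervalIntegral.integral_pos (by norm_num)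
    (by fun_prop) (fun _ _ => by positivity) ⟨y, hy, by positivity⟩)

/-- If `φ` vanishes on `[-1, 1]`, so does its fourth derivative. -/
theorem fourth_eqOn_zero (h : IsClamped φ φ₁ φ₂ φ₃ φ₄) (hφ : ∀ y ∈ Set.Icc (-1 : ℝ) 1, φ y = 0) :
    ∀ y ∈ Set.Icc (-1 : ℝ) 1, φ₄ y = 0 := by
  have step : ∀ f f' : ℝ → ℂ, (∀ y, HasDerivAt f (f' y) y) →
      (∀ y ∈ Set.Ioo (-1 : ℝ) 1, f y = 0) → ∀ y ∈ Set.Ioo (-1 : ℝ) 1, f' y = 0 := by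
    intro f f' hd hf y hy
    have hev : f =ᶠ[nhds y] fun _ => 0 :=
      Filter.eventually_of_mem (isOpen_Ioo.mem_nhds hy) hf
    exact (hd y).unique ((hasDerivAt_const y (0 : ℂ)).congr_of_eventuallyEq hev)
  have h4 := step _ _ h.deriv₃ <| step _ _ h.deriv₂ <| step _ _ h.deriv₁ <| step _ _ h.deriv₀
    fun y hy => hφ y (Set.Ioo_subset_Icc_self hy)
  have hcl : Set.EqOn φ₄ (fun _ => 0) (closure (Set.Ioo (-1) 1)) :=
    Set.EqOn.closure h4 h.cont₄ continuous_const
  rwa [closure_Ioo (by norm_num)] at hcl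

theorem sub {ψ ψ₁ ψ₂ ψ₃ ψ₄ : ℝ → ℂ} (h : IsClamped φ φ₁ φ₂ φ₃ φ₄)
    (k : IsClamped ψ ψ₁ ψ₂ ψ₃ ψ₄) :
    IsClamped (φ - ψ) (φ₁ - ψ₁) (φ₂ - ψ₂) (φ₃ - ψ₃) (φ₄ - ψ₄) where
  deriv₀ y := (h.deriv₀ y).sub (k.deriv₀ y)
  deriv₁ y := (h.deriv₁ y).sub (k.deriv₁ y)
  deriv₂ y := (h.deriv₂ y).sub (k.deriv₂ y)
  deriv₃ y := (h.deriv₃ y).sub (k.deriv₃ y)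
  cont₄ := h.cont₄.sub k.cont₄
  left₀ := by simp [h.left₀, k.left₀]
  right₀ := by simp [h.right₀, k.right₀]
  left₁ := by simp [h.left₁, k.left₁]
  right₁ := by simp [h.right₁, k.right₁]

theorem deriv_eq (h : IsClamped φ φ₁ φ₂ φ₃ φ₄) : deriv φ = φ₁ := funext fun y => (h.deriv₀ y).deriv

theorem iteratedDeriv_two_eq (h : IsClamped φ φ₁ φ₂ φ₃ φ₄) : iteratedDeriv 2 φ = φ₂ := by
  rw [iteratedDeriv_succ, iteratedDeriv_one, h.deriv_eq]
  exact funext fun y => (h.deriv₁ y).deriv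

theorem iteratedDeriv_three_eq (h : IsClamped φ φ₁ φ₂ φ₃ φ₄) : iteratedDeriv 3 φ = φ₃ := by
  rw [iteratedDeriv_succ, h.iteratedDeriv_two_eq]
  exact funext fun y => (h.deriv₂ y).deriv

theorem iteratedDeriv_four_eq (h : IsClamped φ φ₁ φ₂ φ₃ φ₄) : iteratedDeriv 4 φ = φ₄ := by
  rw [iteratedDeriv_succ, h.iteratedDeriv_three_eq]
  exact funext fun y => (h.deriv₃ y).deriv

theorem contDiff (h : IsClamped φ φ₁ φ₂ φ₃ φ₄) : ContDiff ℝ 4 φ := by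
  refine contDiff_nat_iff_iteratedDeriv.2 ⟨fun m hm => ?_, fun m hm => ?_⟩
  · interval_cases m
    · simpa using h.cont₀
    · simpa [iteratedDeriv_one, h.deriv_eq] using h.cont₁
    · simpa [h.iteratedDeriv_two_eq] using h.cont₂
    · simpa [h.iteratedDeriv_three_eq] using h.cont₃
    · simpa [h.iteratedDeriv_four_eq] using h.cont₄
  · interval_cases m
    · simpa using
        (show Differentiable ℝ φ from fun y => (h.deriv₀ y).differentiableAt)
    · simpa [iteratedDeriv_one, h.deriv_eq] using
        (show Differentiable ℝ φ₁ from fun y => (h.deriv₁ y).differentiableAt)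
    · simpa [h.iteratedDeriv_two_eq] using
        (show Differentiable ℝ φ₂ from fun y => (h.deriv₂ y).differentiableAt)
    · simpa [h.iteratedDeriv_three_eq] using
        (show Differentiable ℝ φ₃ from fun y => (h.deriv₃ y).differentiableAt)

theorem of_contDiff (hφ : ContDiff ℝ 4 φ) (l0 : φ (-1) = 0) (r0 : φ 1 = 0)
    (l1 : deriv φ (-1) = 0) (r1 : deriv φ 1 = 0) :
    IsClamped φ (deriv φ) (iteratedDeriv 2 φ) (iteratedDeriv 3 φ) (iteratedDeriv 4 φ) := by
  have d : ∀ m : ℕ, m < 4 → ∀ y,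
      HasDerivAt (iteratedDeriv m φ) (iteratedDeriv (m + 1) φ y) y := by
    intro m hm y
    rw [iteratedDeriv_succ]
    exact (hφ.differentiable_iteratedDeriv m (by exact_mod_cast hm) y).hasDerivAt
  refine ⟨fun y => ?_, fun y => ?_, d 2 (by norm_num), d 3 (by norm_num),
    hφ.continuous_iteratedDeriv 4 le_rfl, l0, r0, l1, r1⟩
  · simpa using d 0 (by norm_num) y
  · simpa using d 1 (by norm_num) y

end IsClamped

/-- The primitive of `f` vanishing at `-1`. -/
noncomputable def primitive (f : ℝ → ℂ) (y : ℝ) : ℂ := ∫ t in (-1 : ℝ)..y, f t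

theorem hasDerivAt_primitive {f : ℝ → ℂ} (hf : Continuous f) (y : ℝ) :
    HasDerivAt (primitive f) (f y) y :=
  (hf.integral_hasStrictDerivAt (-1) y).hasDerivAt

theorem continuous_primitive_of_continuous {f : ℝ → ℂ} (hf : Continuous f) :
    Continuous (primitive f) :=
  continuous_iff_continuousAt.2 fun y => (hasDerivAt_primitive hf y).continuousAt

theorem primitive_neg_one (f : ℝ → ℂ) : primitive f (-1) = 0 := integral_same

/-- The quadratic coefficient of the cubic correction that clamps the fourfold primitive. -/
noncomputable def clampQuad (p q : ℂ) : ℂ := (2 * q - 3 * p) / 4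

/-- The cubic coefficient of the cubic correction that clamps the fourfold primitive. -/
noncomputable def clampCubic (p q : ℂ) : ℂ := (p - q) / 4

/-- The clamped solution of `φ'''' = f`, with its derivatives. -/
theorem isClamped_primitive {f : ℝ → ℂ} (hf : Continuous f) {a b : ℂ}
    (ha : a = clampQuad (primitive (primitive (primitive (primitive f))) 1)
      (primitive (primitive (primitive f)) 1))
    (hb : b = clampCubic (primitive (primitive (primitive (primitive f))) 1)
      (primitive (primitive (primitive f)) 1)) :
    IsClamped
      (fun y => primitive (primitive (primitive (primitive f))) y
        + a * ((y : ℂ) + 1) ^ 2 + b * ((y : ℂ) + 1) ^ 3)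
      (fun y => primitive (primitive (primitive f)) y
        + 2 * a * ((y : ℂ) + 1) + 3 * b * ((y : ℂ) + 1) ^ 2)
      (fun y => primitive (primitive f) y + 2 * a + 6 * b * ((y : ℂ) + 1))
      (fun y => primitive f y + 6 * b) f := by
  have c1 := continuous_primitive_of_continuous hf
  have c2 := continuous_primitive_of_continuous c1
  have c3 := continuous_primitive_of_continuous c2
  have dlin : ∀ y : ℝ, HasDerivAt (fun t : ℝ => (t : ℂ) + 1) 1 y := fun y =>
    ((hasDerivAt_id y).ofReal_comp).add_const 1
  refine ⟨fun y => ?_, fun y => ?_, fun y => ?_, fun y => ?_, hf, ?_, ?_, ?_, ?_⟩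
  · refine (((hasDerivAt_primitive c3 y).add (((dlin y).pow 2).const_mul a)).add
      (((dlin y).pow 3).const_mul b)).congr_deriv ?_
    push_cast
    ring
  · refine (((hasDerivAt_primitive c2 y).add ((dlin y).const_mul (2 * a))).add
      (((dlin y).pow 2).const_mul (3 * b))).congr_deriv ?_
    push_cast
    ring
  · refine (((hasDerivAt_primitive c1 y).add_const (2 * a)).add
      ((dlin y).const_mul (6 * b))).congr_deriv ?_
    ring
  · exact (hasDerivAt_primitive hf y).add_const _
  · simp [primitive_neg_one]
  · rw [ha, hb, clampQuad, clampCubic]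
    push_cast
    ring
  · simp [primitive_neg_one]
  · rw [ha, hb, clampQuad, clampCubic]
    push_cast
    ring

/-- Integration from `-1` as a linear map on the continuous functions on `[-1, 1]`. -/
noncomputable def primitiveLinearMap : C(Set.Icc (-1 : ℝ) 1, ℂ) →ₗ[ℂ] C(Set.Icc (-1 : ℝ) 1, ℂ) where
  toFun u :=
    ⟨fun y => primitive (Set.IccExtend (show (-1 : ℝ) ≤ 1 by norm_num) u) y,
      (continuous_primitive_of_continuous (u.continuous.Icc_extend'
        (h := show (-1 : ℝ) ≤ 1 by norm_num))).comp continuous_subtype_val⟩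
  map_add' u v := by
    ext y
    exact intervalIntegral.integral_add (u.continuous.Icc_extend'.intervalIntegrable _ _)
      (v.continuous.Icc_extend'.intervalIntegrable _ _)
  map_smul' r u := by
    ext y
    exact intervalIntegral.integral_smul r _

/-- Integration from `-1` as an operator on the continuous functions on `[-1, 1]`. -/
noncomputable def primitiveCLM : C(Set.Icc (-1 : ℝ) 1, ℂ) →L[ℂ] C(Set.Icc (-1 : ℝ) 1, ℂ) :=
  primitiveLinearMap.mkContinuous 2 fun u => by
    refine (ContinuousMap.norm_le _ (by positivity)).2 fun y => ?_
    refine (intervalIntegral.norm_integral_le_of_norm_le_const (C := ‖u‖)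
      fun t _ => u.norm_coe_le_norm _).trans ?_
    rw [mul_comm]
    gcongr
    rw [abs_of_nonneg] <;> linarith [y.2.1, y.2.2]

theorem primitiveCLM_apply {u : C(Set.Icc (-1 : ℝ) 1, ℂ)} {g : ℝ → ℂ}
    (h : ∀ t : Set.Icc (-1 : ℝ) 1, u t = g t) (y : Set.Icc (-1 : ℝ) 1) :
    primitiveCLM u y = primitive g y := by
  refine integral_congr fun t ht => ?_
  rw [Set.uIcc_of_le y.2.1] at ht
  have ht' : t ∈ Set.Icc (-1 : ℝ) 1 := ⟨ht.1, ht.2.trans y.2.2⟩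
  simp only [Set.IccExtend_of_mem _ _ ht']
  exact h ⟨t, ht'⟩

theorem norm_primitiveCLM_sub_le (u : C(Set.Icc (-1 : ℝ) 1, ℂ)) (x y : Set.Icc (-1 : ℝ) 1) :
    ‖primitiveCLM u x - primitiveCLM u y‖ ≤ ‖u‖ * |(x : ℝ) - y| := by
  have hc : Continuous (Set.IccExtend (show (-1 : ℝ) ≤ 1 by norm_num) u) := by fun_prop
  have : primitiveCLM u x - primitiveCLM u y =
      ∫ t in (y : ℝ)..x, Set.IccExtend (show (-1 : ℝ) ≤ 1 by norm_num) u t :=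
    integral_interval_sub_left (hc.intervalIntegrable _ _) (hc.intervalIntegrable _ _)
  rw [this]
  exact intervalIntegral.norm_integral_le_of_norm_le_const fun t _ => u.norm_coe_le_norm _

theorem primitiveCLM_neg_one (u : C(Set.Icc (-1 : ℝ) 1, ℂ)) (h : (-1 : ℝ) ∈ Set.Icc (-1 : ℝ) 1) :
    primitiveCLM u ⟨-1, h⟩ = 0 :=
  primitive_neg_one _

theorem isCompactOperator_primitiveCLM : IsCompactOperator primitiveCLM := by
  rw [isCompactOperator_iff_exists_mem_nhds_image_subset_compact]
  let S : Set C(Set.Icc (-1 : ℝ) 1, ℂ) :=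
    {f | (∀ x, f x ∈ Metric.closedBall (0 : ℂ) 2) ∧ ∀ x y, dist (f x) (f y) ≤ dist x y}
  refine ⟨Metric.closedBall 0 1, Metric.closedBall_mem_nhds _ one_pos, S,
    ArzelaAscoli.isCompact_of_equicontinuous S ?_ ?_, ?_⟩
  · have himage : ContinuousMap.toFun '' S =
        (Set.univ.pi fun _ => Metric.closedBall (0 : ℂ) 2) ∩
          {f | ∀ x y, dist (f x) (f y) ≤ dist x y} := by
      ext f
      constructor
      · rintro ⟨g, hg, rfl⟩
        exact ⟨fun x _ => hg.1 x, hg.2⟩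
      · rintro ⟨h1, h2⟩
        exact ⟨⟨f, (LipschitzWith.of_dist_le_mul (K := 1) (by simpa using h2)).continuous⟩,
          ⟨fun x => h1 x trivial, h2⟩, rfl⟩
    rw [himage]
    refine (isCompact_univ_pi fun _ => isCompact_closedBall _ _).inter_right ?_
    simp only [Set.ofPred_forall]
    exact isClosed_iInter fun x => isClosed_iInter fun y =>
      isClosed_le (by fun_prop) continuous_const
  · exact (LipschitzWith.uniformEquicontinuous _ 1 fun f =>
      LipschitzWith.of_dist_le_mul (by simpa using f.2.2)).equicontinuous
  · rintro _ ⟨u, hu, rfl⟩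
    have hu' : ‖u‖ ≤ 1 := by simpa using hu
    have hlip : ∀ x y, dist (primitiveCLM u x) (primitiveCLM u y) ≤ dist x y := fun x y => by
      rw [dist_eq_norm, Subtype.dist_eq, Real.dist_eq]
      exact (norm_primitiveCLM_sub_le u x y).trans (mul_le_of_le_one_left (abs_nonneg _) hu')
    refine ⟨fun x => ?_, hlip⟩
    have h0 := hlip x ⟨-1, by norm_num⟩
    rw [primitiveCLM_neg_one, Subtype.dist_eq, Real.dist_eq] at h0
    refine h0.trans ?_
    rw [abs_of_nonneg] <;> linarith [x.2.1, x.2.2]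

/-- The Orr–Sommerfeld operator in terms of the fourth derivative is a compact perturbation of the
identity. -/
theorem exists_orrSommerfeld_eq_add (A B C ξ : ℝ) :
    ∃ K : C(Set.Icc (-1 : ℝ) 1, ℂ) →L[ℂ] C(Set.Icc (-1 : ℝ) 1, ℂ), IsCompactOperator K ∧
      ∀ u : C(Set.Icc (-1 : ℝ) 1, ℂ), ∃ φ φ₁ φ₂ φ₃ φ₄ : ℝ → ℂ, IsClamped φ φ₁ φ₂ φ₃ φ₄ ∧
        ∀ y : Set.Icc (-1 : ℝ) 1, φ₄ y = u y ∧
          orrSommerfeld A B C ξ φ φ₂ φ₄ y = u y + K u y := by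
  let J := primitiveCLM
  let ev : C(Set.Icc (-1 : ℝ) 1, ℂ) →L[ℂ] ℂ := ContinuousMap.evalCLM ℂ ⟨1, by norm_num⟩
  let p := ev ∘L J ∘L J ∘L J
  let q := ev ∘L J ∘L J
  let a := (4⁻¹ : ℂ) • ((2 : ℂ) • q - (3 : ℂ) • p)
  let b := (4⁻¹ : ℂ) • (p - q)
  let e : C(Set.Icc (-1 : ℝ) 1, ℂ) := ⟨fun y => ((y : ℝ) : ℂ) + 1, by fun_prop⟩
  let F : C(Set.Icc (-1 : ℝ) 1, ℂ) :=
    ⟨fun y => ((3 * A * (y : ℝ) ^ 2 + B * (y : ℝ) + C : ℝ) : ℂ), by fun_prop⟩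
  let P₀ := J ∘L J ∘L J + a.smulRight (e ^ 2) + b.smulRight (e ^ 3)
  let P₂ := J + ((2 : ℂ) • a).smulRight 1 + ((6 : ℂ) • b).smulRight e
  let m₂ : C(Set.Icc (-1 : ℝ) 1, ℂ) :=
    ContinuousMap.const _ (-2 * (ξ : ℂ) ^ 2) - (Complex.I * (ξ : ℂ)) • F
  let m₀ : C(Set.Icc (-1 : ℝ) 1, ℂ) :=
    ContinuousMap.const _ ((ξ : ℂ) ^ 4 + 6 * Complex.I * ξ * A) + (Complex.I * (ξ : ℂ) ^ 3) • F
  let N := ContinuousLinearMap.mul ℂ _ m₂ ∘L P₂ + ContinuousLinearMap.mul ℂ _ m₀ ∘L P₀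
  refine ⟨N ∘L J, isCompactOperator_primitiveCLM.clm_comp N, fun u => ?_⟩
  let f : ℝ → ℂ := Set.IccExtend (show (-1 : ℝ) ≤ 1 by norm_num) u
  have hf : Continuous f := by fun_prop
  have h0 : ∀ y : Set.Icc (-1 : ℝ) 1, u y = f y := fun y => (Set.IccExtend_val _ _ y).symm
  have h1 := primitiveCLM_apply h0
  have h2 := primitiveCLM_apply h1
  have h3 := primitiveCLM_apply h2
  have h4 := primitiveCLM_apply h3
  have hp : p (J u) = primitive (primitive (primitive (primitive f))) 1 := h4 _
  have hq : q (J u) = primitive (primitive (primitive f)) 1 := h3 _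
  refine ⟨_, _, _, _, f, isClamped_primitive hf (a := a (J u)) (b := b (J u)) ?_ ?_,
    fun y => ⟨(h0 y).symm, ?_⟩⟩
  · simp only [a, smul_apply, sub_apply, hp, hq,
      clampQuad, smul_eq_mul]
    ring
  · simp only [b, smul_apply, sub_apply, hp, hq,
      clampCubic, smul_eq_mul]
    ring
  · have hP₂ : P₂ (J u) y = primitive (primitive f) y + 2 * a (J u) + 6 * b (J u) * (y + 1) := by
      rw [← h2 y]
      simp [P₂, J, e]
    have hP₀ : P₀ (J u) y = primitive (primitive (primitive (primitive f))) y
        + a (J u) * ((y : ℝ) + 1) ^ 2 + b (J u) * ((y : ℝ) + 1) ^ 3 := by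
      rw [← h4 y]
      simp [P₀, J, e]
    have hN : (N ∘L J) u y = m₂ y * P₂ (J u) y + m₀ y * P₀ (J u) y := rfl
    have hm₂ : m₂ y = -2 * (ξ : ℂ) ^ 2 - Complex.I * ξ * F y := rfl
    have hm₀ : m₀ y = (ξ : ℂ) ^ 4 + 6 * Complex.I * ξ * A + Complex.I * (ξ : ℂ) ^ 3 * F y := rfl
    have hF : F y = ((3 * A * (y : ℝ) ^ 2 + B * (y : ℝ) + C : ℝ) : ℂ) := rfl
    rw [hN, hP₂, hP₀, hm₂, hm₀, hF, h0 y]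
    simp only [orrSommerfeld]
    ring

/-- The clamped Orr–Sommerfeld problem is solvable for every continuous datum. -/
theorem exists_isClamped_orrSommerfeld_eq {A B C ξ : ℝ} (hABC : (A, B, C) ≠ (0, 0, 0))
    (hA : A ≤ 0) (hB : |B| ≤ 3 * A + C) (hξ : ξ ≠ 0) {h : ℝ → ℂ}
    (hh : ContinuousOn h (Set.Icc (-1 : ℝ) 1)) :
    ∃ φ φ₁ φ₂ φ₃ φ₄ : ℝ → ℂ, IsClamped φ φ₁ φ₂ φ₃ φ₄ ∧
      ∀ y ∈ Set.Icc (-1 : ℝ) 1, orrSommerfeld A B C ξ φ φ₂ φ₄ y = h y := by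
  obtain ⟨K, hK, hOS⟩ := exists_orrSommerfeld_eq_add A B C ξ
  have hK' : IsCompactOperator (-K : C(Set.Icc (-1 : ℝ) 1, ℂ) →L[ℂ] C(Set.Icc (-1 : ℝ) 1, ℂ)) :=
    hK.neg
  rcases hK'.hasEigenvalue_or_mem_resolventSet one_ne_zero with hev | hres
  · obtain ⟨u, hu⟩ := hev.exists_hasEigenvector
    have hKu : -K u = u := by simpa using hu.apply_eq_smul
    obtain ⟨φ, φ₁, φ₂, φ₃, φ₄, hφ, hy⟩ := hOS u
    refine absurd (ContinuousMap.ext fun y => ?_) hu.2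
    rw [← (hy y).1]
    refine hφ.fourth_eqOn_zero (hφ.eqOn_zero hABC hA hB hξ fun t ht => ?_) y y.2
    rw [(hy ⟨t, Set.Ioo_subset_Icc_self ht⟩).2]
    have := DFunLike.congr_fun hKu ⟨t, Set.Ioo_subset_Icc_self ht⟩
    rw [← this]
    simp
  · rw [spectrum.mem_resolventSet_iff] at hres
    obtain ⟨v, hv⟩ := hres.exists_right_inv
    let g : C(Set.Icc (-1 : ℝ) 1, ℂ) := ⟨_, hh.domRestrict⟩
    have hvg : v g + K (v g) = g := by
      simpa using DFunLike.congr_fun hv g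
    obtain ⟨φ, φ₁, φ₂, φ₃, φ₄, hφ, hy⟩ := hOS (v g)
    refine ⟨φ, φ₁, φ₂, φ₃, φ₄, hφ, fun y hy' => ?_⟩
    rw [(hy ⟨y, hy'⟩).2]
    exact DFunLike.congr_fun hvg ⟨y, hy'⟩

/-- Proposition 3.1 of the paper: under condition (ABC), for every `ξ ≠ 0` and every
continuous datum `h` there is exactly one (on `[-1,1]`) `C⁴` solution `φ` of the
non-homogeneous Orr–Sommerfeld problem, and it satisfies
`∫(|φ''|² + 2ξ²|φ'|² + ξ⁴|φ|²) ≤ c·ξ⁻²·∫|h|²` with `c` depending only on `A, B, C`. -/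
theorem stmt_10 (A B C : ℝ) (hABC : (A, B, C) ≠ (0, 0, 0)) (hA : A ≤ 0)
    (hB : |B| ≤ 3 * A + C) :
    ∃ c > 0, ∀ (ξ : ℝ), ξ ≠ 0 → ∀ h : ℝ → ℂ, ContinuousOn h (Set.Icc (-1 : ℝ) 1) →
      ∃ φ : ℝ → ℂ,
        (ContDiff ℝ 4 φ ∧
          (∀ y ∈ Set.Ioo (-1 : ℝ) 1,
            iteratedDeriv 4 φ y - 2 * (ξ : ℂ) ^ 2 * iteratedDeriv 2 φ y + (ξ : ℂ) ^ 4 * φ y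
              - Complex.I * (ξ : ℂ) *
                  (((3 * A * y ^ 2 + B * y + C : ℝ) : ℂ) *
                      (iteratedDeriv 2 φ y - (ξ : ℂ) ^ 2 * φ y)
                    - 6 * (A : ℂ) * φ y) = h y) ∧
          φ (-1) = 0 ∧ φ 1 = 0 ∧ deriv φ (-1) = 0 ∧ deriv φ 1 = 0) ∧
        (∫ y in (-1 : ℝ)..1,
            (‖iteratedDeriv 2 φ y‖ ^ 2 + 2 * ξ ^ 2 * ‖deriv φ y‖ ^ 2 + ξ ^ 4 * ‖φ y‖ ^ 2))
          ≤ c * ξ⁻¹ ^ 2 * ∫ y in (-1 : ℝ)..1, ‖h y‖ ^ 2 ∧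
        (∀ φ' : ℝ → ℂ, ContDiff ℝ 4 φ' →
          (∀ y ∈ Set.Ioo (-1 : ℝ) 1,
            iteratedDeriv 4 φ' y - 2 * (ξ : ℂ) ^ 2 * iteratedDeriv 2 φ' y + (ξ : ℂ) ^ 4 * φ' y
              - Complex.I * (ξ : ℂ) *
                  (((3 * A * y ^ 2 + B * y + C : ℝ) : ℂ) *
                      (iteratedDeriv 2 φ' y - (ξ : ℂ) ^ 2 * φ' y)
                    - 6 * (A : ℂ) * φ' y) = h y) →
          φ' (-1) = 0 → φ' 1 = 0 → deriv φ' (-1) = 0 → deriv φ' 1 = 0 →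
          ∀ y ∈ Set.Icc (-1 : ℝ) 1, φ' y = φ y) := by
  obtain ⟨c, hc, hE⟩ := IsClamped.exists_integral_energy_le hABC hA hB
  refine ⟨c, hc, fun ξ hξ h hh => ?_⟩
  obtain ⟨φ, φ₁, φ₂, φ₃, φ₄, hφ, heq⟩ := exists_isClamped_orrSommerfeld_eq hABC hA hB hξ hh
  refine ⟨φ, ⟨hφ.contDiff, fun y hy => ?_, hφ.left₀, hφ.right₀, ?_, ?_⟩, ?_, ?_⟩
  · rw [hφ.iteratedDeriv_four_eq, hφ.iteratedDeriv_two_eq]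
    exact heq y (Set.Ioo_subset_Icc_self hy)
  · rw [hφ.deriv_eq, hφ.left₁]
  · rw [hφ.deriv_eq, hφ.right₁]
  · rw [hφ.deriv_eq, hφ.iteratedDeriv_two_eq]
    refine (hE ξ hξ φ φ₁ φ₂ φ₃ φ₄ hφ).trans_eq ?_
    congr 1
    refine integral_congr fun y hy => ?_
    rw [Set.uIcc_of_le (by norm_num)] at hy
    simp only [heq y hy]
  · intro ψ hψ hψeq l0 r0 l1 r1 y hy
    have hψ' := IsClamped.of_contDiff hψ l0 r0 l1 r1
    refine sub_eq_zero.1 ((hψ'.sub hφ).eqOn_zero hABC hA hB hξ (fun t ht => ?_) y hy)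
    have e1 := hψeq t ht
    have e2 := heq t (Set.Ioo_subset_Icc_self ht)
    simp only [orrSommerfeld] at e2
    simp only [orrSommerfeld, Pi.sub_apply]
    linear_combination e1 - e2
end
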